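/- arXiv:1610.02934 — 2 statements merged into one kernel-verified Lean document; each statement's English description precedes it below -/
import Mathlib

section
/- Let T and T′ be triangulations of the ∞-gon that both have a right fountain at b ∈ ℤ. Then there exists a T-admissible sequence θ such that μ_θ(T)|_{[b,∞)} = T′|_{[b,∞)} and θ leaves every arc in T \ T|_{[b,∞)} untouched. -/
open scoped Classical

/-- An arc of the ∞-gon: a pair of integers `(i,j)` with `i ≤ j − 2`. -/
structure ArcZ where
  src : ℤ
  tgt : ℤ
  sep : src + 2 ≤ tgt

/-- Two arcs `(i,j)` and `(k,l)` cross if `i < k < j < l` or `k < i < l < j`. -/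
def CrossZ (x y : ArcZ) : Prop :=
  (x.src < y.src ∧ y.src < x.tgt ∧ x.tgt < y.tgt) ∨
  (y.src < x.src ∧ x.src < y.tgt ∧ y.tgt < x.tgt)

/-- A triangulation of the ∞-gon: a maximal set of pairwise compatible
(= non-crossing) arcs. -/
def IsTriangulationZ (T : Set ArcZ) : Prop :=
  (∀ x ∈ T, ∀ y ∈ T, ¬ CrossZ x y) ∧
  ∀ γ : ArcZ, (∀ x ∈ T, ¬ CrossZ γ x) → γ ∈ T

/-- `T` has a right fountain at `n`. -/
def RightFountainZ (T : Set ArcZ) (n : ℤ) : Prop :=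
  {p : ℤ | ∃ γ ∈ T, γ.src = n ∧ γ.tgt = p}.Infinite

/-- `T` has a left fountain at `n`. -/
def LeftFountainZ (T : Set ArcZ) (n : ℤ) : Prop :=
  {p : ℤ | ∃ γ ∈ T, γ.src = p ∧ γ.tgt = n}.Infinite

/-- `T` is locally finite if every integer is an endpoint of only finitely many arcs of `T`. -/
def LocallyFinZ (T : Set ArcZ) : Prop :=
  ∀ v : ℤ, {γ | γ ∈ T ∧ (γ.src = v ∨ γ.tgt = v)}.Finite

/-- `γ'` is an exchange partner for `γ` relative to `T`:
it is distinct from `γ` and `(T \ {γ}) ∪ {γ'}` is again a triangulation. -/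
def MutExchangeZ (T : Set ArcZ) (γ γ' : ArcZ) : Prop :=
  γ' ≠ γ ∧ IsTriangulationZ ((T \ {γ}) ∪ {γ'})

/-- `γ` is a mutable arc of `T`. -/
def IsMutableZ (T : Set ArcZ) (γ : ArcZ) : Prop :=
  γ ∈ T ∧ ∃ γ', MutExchangeZ T γ γ'

/-- The (unique) replacement arc of `γ` in `T`, when `γ` is mutable. -/
noncomputable def flipArcZ (T : Set ArcZ) (γ : ArcZ) : ArcZ :=
  if h : ∃ γ', MutExchangeZ T γ γ' then h.choose else γ

/-- The mutation `μ_γ(T)` of `T` at `γ`. -/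
noncomputable def mutateZ (T : Set ArcZ) (γ : ArcZ) : Set ArcZ :=
  (T \ {γ}) ∪ {flipArcZ T γ}

/-- `μ_γ(δ)`: the effect of the mutation of `T` at `γ` on the arc `δ`. -/
noncomputable def mutArcZ (T : Set ArcZ) (γ δ : ArcZ) : ArcZ :=
  if δ = γ then flipArcZ T γ else δ

/-- One step of a mutation sequence on a set of arcs (`none` = no entry). -/
noncomputable def stepTZ (T : Set ArcZ) : Option ArcZ → Set ArcZ
  | none => T
  | some γ => mutateZ T γ

/-- One step of a mutation sequence on a single arc. -/
noncomputable def stepAZ (T : Set ArcZ) : Option ArcZ → ArcZ → ArcZ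
  | none, δ => δ
  | some γ, δ => mutArcZ T γ δ

/-- `iterTZ T θ k` is `μ_{θ_k} ∘ ⋯ ∘ μ_{θ_1}(T)`. Sequences (finite or infinite) are
encoded as `θ : ℕ → Option ArcZ` whose support is downward closed. -/
noncomputable def iterTZ (T : Set ArcZ) (θ : ℕ → Option ArcZ) : ℕ → Set ArcZ
  | 0 => T
  | k + 1 => stepTZ (iterTZ T θ k) (θ k)

/-- `iterAZ T θ γ k` is `μ_{θ_k} ∘ ⋯ ∘ μ_{θ_1}(γ)`. -/
noncomputable def iterAZ (T : Set ArcZ) (θ : ℕ → Option ArcZ) (γ : ArcZ) : ℕ → ArcZ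
  | 0 => γ
  | k + 1 => stepAZ (iterTZ T θ k) (θ k) (iterAZ T θ γ k)

/-- `θ` is a `T`-admissible sequence: its support is downward closed (so it is a genuine
finite or infinite sequence), each entry is mutable in the triangulation obtained by the
previous mutations, and the mutation of each arc of `T` along `θ` eventually stabilizes. -/
def AdmissibleZ (T : Set ArcZ) (θ : ℕ → Option ArcZ) : Prop :=
  (∀ i, θ i = none → θ (i + 1) = none) ∧
  (∀ i γ, θ i = some γ → IsMutableZ (iterTZ T θ i) γ) ∧
  (∀ γ ∈ T, ∃ l, ∀ k, l ≤ k → iterAZ T θ γ k = iterAZ T θ γ l)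

/-- `μ_θ(γ)`: the stable value of the mutation of the arc `γ` along the sequence `θ`. -/
noncomputable def seqLimitZ (T : Set ArcZ) (θ : ℕ → Option ArcZ) (γ : ArcZ) : ArcZ :=
  if h : ∃ l, ∀ k, l ≤ k → iterAZ T θ γ k = iterAZ T θ γ l
  then iterAZ T θ γ h.choose else γ

/-- `μ_θ(T)`: the mutation of `T` along the sequence `θ`. -/
noncomputable def mutSeqZ (T : Set ArcZ) (θ : ℕ → Option ArcZ) : Set ArcZ :=
  seqLimitZ T θ '' T

/-- The sequence `θ` leaves the arc `γ` untouched. -/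
def UntouchedZ (T : Set ArcZ) (θ : ℕ → Option ArcZ) (γ : ArcZ) : Prop :=
  ∀ l, iterAZ T θ γ l = γ

/-- The quadrilateral `S(γ)` of a mutable arc `γ` in `T`: with `v₁ < v₂ < v₃ < v₄` the four
endpoints of the two diagonals `γ` and `flipArcZ T γ`, it consists of those of the pairs
`(v₁,v₂), (v₂,v₃), (v₃,v₄), (v₁,v₄)` that are arcs. -/
noncomputable def quadZ (T : Set ArcZ) (γ : ArcZ) : Set ArcZ :=
  let γ' := flipArcZ T γ
  let vs : ℤ × ℤ × ℤ × ℤ :=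
    if γ.src < γ'.src then (γ.src, γ'.src, γ.tgt, γ'.tgt) else (γ'.src, γ.src, γ'.tgt, γ.tgt)
  {δ : ArcZ | (δ.src = vs.1 ∧ δ.tgt = vs.2.1) ∨ (δ.src = vs.2.1 ∧ δ.tgt = vs.2.2.1) ∨
    (δ.src = vs.2.2.1 ∧ δ.tgt = vs.2.2.2) ∨ (δ.src = vs.1 ∧ δ.tgt = vs.2.2.2)}

/-- The restriction `T|_S` of a set of arcs to a set `S` of vertices. -/
def restrictZ (T : Set ArcZ) (S : Set ℤ) : Set ArcZ :=
  {γ | γ ∈ T ∧ γ.src ∈ S ∧ γ.tgt ∈ S}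

/-- `T ≤_s T'`: there is a `T`-admissible sequence `θ` with `μ_θ(T) = T'`. -/
def leS (T T' : Set ArcZ) : Prop :=
  ∃ θ : ℕ → Option ArcZ, AdmissibleZ T θ ∧ mutSeqZ T θ = T'

namespace Infgon

theorem arc_ext {x y : ArcZ} (h1 : x.src = y.src) (h2 : x.tgt = y.tgt) : x = y := by
  cases x; cases y; simp_all

/-- `(i,j)` is a boundary edge or an arc of `T`. -/
def Edge (T : Set ArcZ) (i j : ℤ) : Prop := j = i + 1 ∨ ∃ γ ∈ T, γ.src = i ∧ γ.tgt = j

theorem edge_nc {T : Set ArcZ} (hT : ∀ x ∈ T, ∀ y ∈ T, ¬ CrossZ x y) {i j : ℤ}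
    (h : Edge T i j) {γ : ArcZ} (hγ : γ ∈ T) :
    ¬ (i < γ.src ∧ γ.src < j ∧ j < γ.tgt) ∧ ¬ (γ.src < i ∧ i < γ.tgt ∧ γ.tgt < j) := by
  rcases h with h | ⟨δ, hδ, rfl, rfl⟩
  · omega
  · have := hT δ hδ γ hγ
    unfold CrossZ at this
    omega

/-- A genuine flip with unique outcome. -/
def Flip (S : Set ArcZ) (γ γ' : ArcZ) : Prop :=
  γ ∈ S ∧ MutExchangeZ S γ γ' ∧ ∀ γ'', MutExchangeZ S γ γ'' → γ'' = γ'

theorem exch_not_mem {S : Set ArcZ} (hS : IsTriangulationZ S) {γ γ' : ArcZ} (hγ : γ ∈ S)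
    (h : MutExchangeZ S γ γ') : γ' ∉ S := by
  intro h'
  have hmem : γ ∈ (S \ {γ}) ∪ {γ'} := by
    apply h.2.2
    rintro x (hx | hx)
    · exact hS.1 γ hγ x hx.1
    · rw [Set.mem_singleton_iff] at hx
      subst hx
      exact hS.1 γ hγ x h'
  rcases hmem with hx | hx
  · exact hx.2 rfl
  · exact h.1 hx.symm

theorem exch_cross {S : Set ArcZ} (hS : IsTriangulationZ S) {γ γ' : ArcZ} (hγ : γ ∈ S)
    (h : MutExchangeZ S γ γ') : CrossZ γ' γ := by
  by_contra hc
  apply exch_not_mem hS hγ h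
  apply hS.2
  intro x hx
  by_cases hxg : x = γ
  · subst hxg; exact hc
  · exact h.2.1 γ' (Or.inr rfl) x (Or.inl ⟨hx, hxg⟩)

theorem edge_diff {S : Set ArcZ} {γ γ' : ArcZ} {i j : ℤ} (h : Edge S i j)
    (hne : ¬ (γ.src = i ∧ γ.tgt = j)) : Edge ((S \ {γ}) ∪ {γ'}) i j := by
  rcases h with h | ⟨δ, hδ, h1, h2⟩
  · exact Or.inl h
  · refine Or.inr ⟨δ, Or.inl ⟨hδ, ?_⟩, h1, h2⟩
    rintro rfl
    exact hne ⟨h1, h2⟩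

theorem edge_free {S : Set ArcZ} {i j : ℤ} (h : Edge S i j) {γ : ArcZ}
    (hγ : ∀ x ∈ S, ¬ CrossZ γ x) :
    ¬ (i < γ.src ∧ γ.src < j ∧ j < γ.tgt) ∧ ¬ (γ.src < i ∧ i < γ.tgt ∧ γ.tgt < j) := by
  rcases h with h | ⟨δ, hδ, rfl, rfl⟩
  · omega
  · have := hγ δ hδ
    unfold CrossZ at this
    omega

theorem quad_num1 {v1 v2 v3 v4 s t : ℤ} (h12 : v1 < v2) (h23 : v2 < v3) (h34 : v3 < v4)
    (a1 : ¬ (v1 < s ∧ s < v2 ∧ v2 < t) ∧ ¬ (s < v1 ∧ v1 < t ∧ t < v2))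
    (a2 : ¬ (v2 < s ∧ s < v3 ∧ v3 < t) ∧ ¬ (s < v2 ∧ v2 < t ∧ t < v3))
    (a3 : ¬ (v3 < s ∧ s < v4 ∧ v4 < t) ∧ ¬ (s < v3 ∧ v3 < t ∧ t < v4))
    (a4 : ¬ (v1 < s ∧ s < v4 ∧ v4 < t) ∧ ¬ (s < v1 ∧ v1 < t ∧ t < v4))
    (hc : (s < v1 ∧ v1 < t ∧ t < v3) ∨ (v1 < s ∧ s < v3 ∧ v3 < t)) : s = v2 ∧ t = v4 := by
  rcases hc with hc | hc <;> constructor <;> omega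

theorem quad_num2 {v1 v2 v3 v4 s t : ℤ} (h12 : v1 < v2) (h23 : v2 < v3) (h34 : v3 < v4)
    (a1 : ¬ (v1 < s ∧ s < v2 ∧ v2 < t) ∧ ¬ (s < v1 ∧ v1 < t ∧ t < v2))
    (a2 : ¬ (v2 < s ∧ s < v3 ∧ v3 < t) ∧ ¬ (s < v2 ∧ v2 < t ∧ t < v3))
    (a3 : ¬ (v3 < s ∧ s < v4 ∧ v4 < t) ∧ ¬ (s < v3 ∧ v3 < t ∧ t < v4))
    (a4 : ¬ (v1 < s ∧ s < v4 ∧ v4 < t) ∧ ¬ (s < v1 ∧ v1 < t ∧ t < v4))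
    (hc : (s < v2 ∧ v2 < t ∧ t < v4) ∨ (v2 < s ∧ s < v4 ∧ v4 < t)) : s = v1 ∧ t = v3 := by
  rcases hc with hc | hc <;> constructor <;> omega

theorem quad_arc {v1 v2 v3 v4 : ℤ} (h12 : v1 < v2) (h23 : v2 < v3) (h34 : v3 < v4)
    {γ γ' δ : ArcZ}
    (hg : (γ.src = v1 ∧ γ.tgt = v3 ∧ γ'.src = v2 ∧ γ'.tgt = v4) ∨
      (γ.src = v2 ∧ γ.tgt = v4 ∧ γ'.src = v1 ∧ γ'.tgt = v3))
    (a1 : ¬ (v1 < δ.src ∧ δ.src < v2 ∧ v2 < δ.tgt) ∧ ¬ (δ.src < v1 ∧ v1 < δ.tgt ∧ δ.tgt < v2))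
    (a2 : ¬ (v2 < δ.src ∧ δ.src < v3 ∧ v3 < δ.tgt) ∧ ¬ (δ.src < v2 ∧ v2 < δ.tgt ∧ δ.tgt < v3))
    (a3 : ¬ (v3 < δ.src ∧ δ.src < v4 ∧ v4 < δ.tgt) ∧ ¬ (δ.src < v3 ∧ v3 < δ.tgt ∧ δ.tgt < v4))
    (a4 : ¬ (v1 < δ.src ∧ δ.src < v4 ∧ v4 < δ.tgt) ∧ ¬ (δ.src < v1 ∧ v1 < δ.tgt ∧ δ.tgt < v4))
    (hc : CrossZ δ γ) : δ = γ' := by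
  unfold CrossZ at hc
  rcases hg with ⟨g1, g2, g3, g4⟩ | ⟨g1, g2, g3, g4⟩
  · rw [g1, g2] at hc
    obtain ⟨k1, k2⟩ := quad_num1 h12 h23 h34 a1 a2 a3 a4 hc
    exact arc_ext (by omega) (by omega)
  · rw [g1, g2] at hc
    obtain ⟨k1, k2⟩ := quad_num2 h12 h23 h34 a1 a2 a3 a4 hc
    exact arc_ext (by omega) (by omega)

theorem flip_of_quad {S : Set ArcZ} (hS : IsTriangulationZ S) {v1 v2 v3 v4 : ℤ}
    (h12 : v1 < v2) (h23 : v2 < v3) (h34 : v3 < v4)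
    (e12 : Edge S v1 v2) (e23 : Edge S v2 v3) (e34 : Edge S v3 v4) (e14 : Edge S v1 v4)
    {γ γ' : ArcZ} (hγ : γ ∈ S)
    (hg : (γ.src = v1 ∧ γ.tgt = v3 ∧ γ'.src = v2 ∧ γ'.tgt = v4) ∨
      (γ.src = v2 ∧ γ.tgt = v4 ∧ γ'.src = v1 ∧ γ'.tgt = v3)) : Flip S γ γ' := by
  have hg' : (γ'.src = v1 ∧ γ'.tgt = v3 ∧ γ.src = v2 ∧ γ.tgt = v4) ∨
      (γ'.src = v2 ∧ γ'.tgt = v4 ∧ γ.src = v1 ∧ γ.tgt = v3) := by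
    rcases hg with ⟨g1, g2, g3, g4⟩ | ⟨g1, g2, g3, g4⟩
    · exact Or.inr ⟨g3, g4, g1, g2⟩
    · exact Or.inl ⟨g3, g4, g1, g2⟩
  have n12 : ¬ (γ.src = v1 ∧ γ.tgt = v2) := by omega
  have n23 : ¬ (γ.src = v2 ∧ γ.tgt = v3) := by omega
  have n34 : ¬ (γ.src = v3 ∧ γ.tgt = v4) := by omega
  have n14 : ¬ (γ.src = v1 ∧ γ.tgt = v4) := by omega
  have hcr : CrossZ γ γ' := by
    unfold CrossZ
    omega
  have hex : MutExchangeZ S γ γ' := by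
    have hne : γ' ≠ γ := by
      rintro rfl
      omega
    have key : ∀ x ∈ S, x ≠ γ → ¬ CrossZ x γ' := by
      intro x hx hxg hc
      have a1 := edge_nc hS.1 e12 hx
      have a2 := edge_nc hS.1 e23 hx
      have a3 := edge_nc hS.1 e34 hx
      have a4 := edge_nc hS.1 e14 hx
      exact hxg (quad_arc (γ := γ') (γ' := γ) h12 h23 h34 hg' a1 a2 a3 a4 hc)
    refine ⟨hne, ?_, ?_⟩
    · rintro x (⟨hx, hxg⟩ | hx) y (⟨hy, hyg⟩ | hy)
      · exact hS.1 x hx y hy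
      · rw [Set.mem_singleton_iff] at hy
        subst hy
        exact key x hx hxg
      · rw [Set.mem_singleton_iff] at hx
        subst hx
        intro hc
        apply key y hy hyg
        exact hc.symm
      · rw [Set.mem_singleton_iff] at hx hy
        subst hx; subst hy
        unfold CrossZ
        omega
    · intro δ hδ
      have a1 := edge_free (edge_diff (γ := γ) (γ' := γ') e12 n12) hδ
      have a2 := edge_free (edge_diff (γ := γ) (γ' := γ') e23 n23) hδ
      have a3 := edge_free (edge_diff (γ := γ) (γ' := γ') e34 n34) hδ
      have a4 := edge_free (edge_diff (γ := γ) (γ' := γ') e14 n14) hδ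
      have a5 := hδ γ' (Or.inr rfl)
      have hsep := δ.sep
      by_cases hc : CrossZ δ γ
      · right
        exact quad_arc h12 h23 h34 hg a1 a2 a3 a4 hc
      · left
        refine ⟨hS.2 δ ?_, ?_⟩
        · intro x hx
          by_cases hxg : x = γ
          · subst hxg; exact hc
          · exact hδ x (Or.inl ⟨hx, hxg⟩)
        · rw [Set.mem_singleton_iff]
          rintro rfl
          exact a5 hcr
  refine ⟨hγ, hex, ?_⟩
  intro δ hδ
  have hc := exch_cross hS hγ hδ
  have hfree : ∀ x ∈ (S \ {γ}) ∪ {δ}, ¬ CrossZ δ x := fun x hx => hδ.2.1 δ (Or.inr rfl) x hx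
  have a1 := edge_free (edge_diff (γ := γ) (γ' := δ) e12 n12) hfree
  have a2 := edge_free (edge_diff (γ := γ) (γ' := δ) e23 n23) hfree
  have a3 := edge_free (edge_diff (γ := γ) (γ' := δ) e34 n34) hfree
  have a4 := edge_free (edge_diff (γ := γ) (γ' := δ) e14 n14) hfree
  exact quad_arc h12 h23 h34 hg a1 a2 a3 a4 hc

theorem flipArc_eq {S : Set ArcZ} {γ γ' : ArcZ} (h : Flip S γ γ') : flipArcZ S γ = γ' := by
  unfold flipArcZ
  have hex : ∃ γ', MutExchangeZ S γ γ' := ⟨γ', h.2.1⟩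
  rw [dif_pos hex]
  exact h.2.2 _ hex.choose_spec

/-- Every arc of a triangulation is the top side of a triangle. -/
theorem exists_apex {T : Set ArcZ} (hT : IsTriangulationZ T) {γ : ArcZ} (hγ : γ ∈ T) :
    ∃ m, γ.src < m ∧ m < γ.tgt ∧ Edge T γ.src m ∧ Edge T m γ.tgt := by
  have hsep := γ.sep
  let F := (Finset.Ioo γ.src γ.tgt).filter (fun m => Edge T γ.src m)
  have hF : F.Nonempty := ⟨γ.src + 1, by
    simp only [F, Finset.mem_filter, Finset.mem_Ioo]
    exact ⟨by omega, Or.inl rfl⟩⟩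
  obtain ⟨m, hm, hmax⟩ := F.exists_max_image id hF
  simp only [F, Finset.mem_filter, Finset.mem_Ioo, id] at hm hmax
  obtain ⟨⟨h1, h2⟩, h3⟩ := hm
  refine ⟨m, h1, h2, h3, ?_⟩
  by_cases hm1 : γ.tgt = m + 1
  · exact Or.inl hm1
  · right
    refine ⟨⟨m, γ.tgt, by omega⟩, hT.2 _ ?_, rfl, rfl⟩
    intro y hy hc
    have b1 := edge_nc hT.1 h3 hy
    have b2 := hT.1 γ hγ y hy
    have b3 : ¬ (y.src = γ.src ∧ y.tgt < γ.tgt ∧ m < y.tgt) := by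
      rintro ⟨e1, e2, e3⟩
      have := hmax y.tgt ⟨⟨by omega, e2⟩, Or.inr ⟨y, hy, e1, rfl⟩⟩
      omega
    unfold CrossZ at hc b2
    simp only at hc
    omega

/-- `γ` is the arc of `T` in slot `x`. -/
def IsA (T : Set ArcZ) (b x : ℤ) (γ : ArcZ) : Prop :=
  γ ∈ T ∧ ((γ.src = b ∧ γ.tgt = x) ∨
    (b < γ.src ∧ γ.src < x ∧ x < γ.tgt ∧ Edge T γ.src x ∧ Edge T x γ.tgt))

theorem fountain_large {T : Set ArcZ} {b : ℤ} (hb : RightFountainZ T b) (N : ℤ) :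
    ∃ γ ∈ T, γ.src = b ∧ N < γ.tgt := by
  by_contra hcon
  push Not at hcon
  apply hb
  apply (Set.finite_Icc b N).subset
  rintro p ⟨γ, hγ, h1, rfl⟩
  have := hcon γ hγ h1
  have := γ.sep
  exact ⟨by omega, by omega⟩

theorem exists_isA {T : Set ArcZ} (hT : IsTriangulationZ T) {b : ℤ} (hb : RightFountainZ T b)
    (x : ℤ) (hx : b + 2 ≤ x) : ∃ γ, IsA T b x γ := by
  by_cases hmem : (⟨b, x, hx⟩ : ArcZ) ∈ T
  · exact ⟨_, hmem, Or.inl ⟨rfl, rfl⟩⟩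
  have hP : ∃ n : ℕ, ∃ γ ∈ T, b < γ.src ∧ γ.src < x ∧ x < γ.tgt ∧ γ.tgt - γ.src = n := by
    have : ∃ y ∈ T, CrossZ ⟨b, x, hx⟩ y := by
      by_contra hcon
      push Not at hcon
      exact hmem (hT.2 _ hcon)
    obtain ⟨y, hy, hc⟩ := this
    obtain ⟨δ, hδ, d1, d2⟩ := fountain_large hb x
    have hd := hT.1 δ hδ y hy
    have := y.sep
    unfold CrossZ at hc hd
    simp only at hc
    exact ⟨(y.tgt - y.src).toNat, y, hy, by omega, by omega, by omega, by omega⟩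
  obtain ⟨γ, hγ, h1, h2, h3, h4⟩ := Nat.find_spec hP
  have hmin : ∀ δ ∈ T, b < δ.src → δ.src < x → x < δ.tgt → γ.tgt - γ.src ≤ δ.tgt - δ.src := by
    intro δ hδ e1 e2 e3
    have := Nat.find_min' hP (m := (δ.tgt - δ.src).toNat) ⟨δ, hδ, e1, e2, e3, by omega⟩
    omega
  obtain ⟨m, m1, m2, m3, m4⟩ := exists_apex hT hγ
  have hmx : m = x := by
    rcases lt_trichotomy m x with hlt | heq | hgt
    · rcases m4 with m4 | ⟨δ, hδ, e1, e2⟩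
      · omega
      · have := hmin δ hδ (by omega) (by omega) (by omega)
        omega
    · exact heq
    · rcases m3 with m3 | ⟨δ, hδ, e1, e2⟩
      · omega
      · have := hmin δ hδ (by omega) (by omega) (by omega)
        omega
  subst hmx
  exact ⟨γ, hγ, Or.inr ⟨h1, h2, h3, m3, m4⟩⟩

theorem isA_unique {T : Set ArcZ} (hT : IsTriangulationZ T) {b x : ℤ} {γ δ : ArcZ}
    (h1 : IsA T b x γ) (h2 : IsA T b x δ) : γ = δ := by
  obtain ⟨hγ, h1⟩ := h1
  obtain ⟨hδ, h2⟩ := h2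
  have hc := hT.1 γ hγ δ hδ
  unfold CrossZ at hc
  rcases h1 with h1 | ⟨a1, a2, a3, a4, a5⟩ <;> rcases h2 with h2 | ⟨c1, c2, c3, c4, c5⟩
  · apply arc_ext <;> omega
  · omega
  · omega
  · have := edge_nc hT.1 a4 hδ
    have := edge_nc hT.1 a5 hδ
    have := edge_nc hT.1 c4 hγ
    have := edge_nc hT.1 c5 hγ
    apply arc_ext <;> omega

theorem isA_inj {T : Set ArcZ} (hT : IsTriangulationZ T) {b x y : ℤ} {γ : ArcZ}
    (h1 : IsA T b x γ) (h2 : IsA T b y γ) : x = y := by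
  obtain ⟨hγ, h1⟩ := h1
  obtain ⟨-, h2⟩ := h2
  have aux : ∀ x y : ℤ, x < y → γ.src < x → y < γ.tgt → Edge T γ.src y → Edge T x γ.tgt →
      False := by
    intro x y hxy k1 k2 k3 k4
    rcases k4 with k4 | ⟨δ, hδ, e1, e2⟩
    · omega
    · have := edge_nc hT.1 k3 hδ
      omega
  rcases h1 with h1 | ⟨a1, a2, a3, a4, a5⟩ <;> rcases h2 with h2 | ⟨c1, c2, c3, c4, c5⟩
  · omega
  · omega
  · omega
  · rcases lt_trichotomy x y with h | h | h
    · exact (aux x y h a2 c3 c4 a5).elim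
    · exact h
    · exact (aux y x h c2 a3 a4 c5).elim

theorem isA_surj {T : Set ArcZ} (hT : IsTriangulationZ T) {b : ℤ} {γ : ArcZ} (hγ : γ ∈ T)
    (hs : b ≤ γ.src) : ∃ x, b + 2 ≤ x ∧ IsA T b x γ := by
  have := γ.sep
  rcases hs.eq_or_lt with h | h
  · exact ⟨γ.tgt, by omega, hγ, Or.inl ⟨h.symm, rfl⟩⟩
  · obtain ⟨m, m1, m2, m3, m4⟩ := exists_apex hT hγ
    exact ⟨m, by omega, hγ, Or.inr ⟨h, m1, m2, m3, m4⟩⟩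

/-- Abstract scheduling lemma. -/
def RR {X : Type} (Step : X → X → Prop) (I : X → Prop) (G : ℕ → X → Prop) (N : ℕ) :
    ℕ → X → Prop
  | 0, s => I s ∧ G N s
  | k + 1, s => ∃ s', Step s s' ∧ RR Step I G N k s'

theorem seq_exists {X : Type} (Step : X → X → Prop) (I : X → Prop) (G : ℕ → X → Prop)
    (hG : ∀ N s t, Step s t → G N s → G N t)
    (hI : ∀ s, I s → ∀ N, ∃ t, Relation.ReflTransGen Step s t ∧ I t ∧ G N t)
    (s0 : X) (h0 : I s0) :
    ∃ s : ℕ → X, s 0 = s0 ∧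
      (∀ n, Step (s n) (s (n + 1)) ∨ (∀ m, n ≤ m → s m = s n)) ∧ ∀ N, ∃ n, G N (s n) := by
  have hRback : ∀ N s t, Relation.ReflTransGen Step s t → (∃ k, RR Step I G N k t) →
      ∃ k, RR Step I G N k s := by
    intro N s t hst ht
    induction hst using Relation.ReflTransGen.head_induction_on with
    | refl => exact ht
    | head h _ ih =>
      obtain ⟨k, hk⟩ := ih
      exact ⟨k + 1, _, h, hk⟩
  have hRI : ∀ N k s, RR Step I G N k s → ∃ t, Relation.ReflTransGen Step s t ∧ I t := by
    intro N k
    induction k with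
    | zero => intro s hs; exact ⟨s, .refl, hs.1⟩
    | succ k ih =>
      rintro s ⟨s', h1, h2⟩
      obtain ⟨t, ht, hIt⟩ := ih s' h2
      exact ⟨t, .head h1 ht, hIt⟩
  let Good : X → Prop := fun s => ∃ t, Relation.ReflTransGen Step s t ∧ I t
  have hgood : ∀ s, Good s → ∀ N, ∃ k, RR Step I G N k s := by
    rintro s ⟨t, hst, hIt⟩ N
    apply hRback N s t hst
    obtain ⟨u, htu, hIu, hGu⟩ := hI t hIt N
    exact hRback N t u htu ⟨0, hIu, hGu⟩
  have hnext : ∀ s : X, ∃ s' : X, Good s → (Good s' ∧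
      (Step s s' ∨ (s' = s ∧ ∀ N, G N s)) ∧
      ∀ N, (∀ M < N, G M s) → ¬ G N s → ∀ k, RR Step I G N k s →
        ∃ k' < k, RR Step I G N k' s') := by
    intro s
    by_cases hs : Good s
    swap
    · exact ⟨s, fun h => absurd h hs⟩
    by_cases hall : ∀ N, G N s
    · exact ⟨s, fun _ => ⟨hs, Or.inr ⟨rfl, hall⟩, fun N _ h => absurd (hall N) h⟩⟩
    push Not at hall
    have hN := Nat.find_spec hall
    have hNm := fun M (h : M < Nat.find hall) => not_not.1 (Nat.find_min hall h)
    generalize Nat.find hall = N at hN hNm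
    have hk := hgood s hs N
    have hks := Nat.find_spec hk
    have hkm := fun M (h : RR Step I G N M s) => Nat.find_min' hk h
    generalize Nat.find hk = k at hks hkm
    cases k with
    | zero => exact absurd hks.2 hN
    | succ k =>
      obtain ⟨s', h1, h2⟩ := hks
      refine ⟨s', fun _ => ⟨hRI N k s' h2, Or.inl h1, ?_⟩⟩
      intro N' hN' hGN' j hj
      have : N' = N := by
        rcases lt_trichotomy N' N with h | h | h
        · exact absurd (hNm N' h) hGN'
        · exact h
        · exact absurd (hN' N h) hN
      subst this
      exact ⟨k, hkm j hj, h2⟩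
  choose next hnext using hnext
  let s : ℕ → X := fun n => Nat.rec s0 (fun _ x => next x) n
  have hs0 : s 0 = s0 := rfl
  have hsn : ∀ n, s (n + 1) = next (s n) := fun n => rfl
  have hgs : ∀ n, Good (s n) := by
    intro n
    induction n with
    | zero => exact ⟨s0, .refl, h0⟩
    | succ n ih => rw [hsn]; exact (hnext _ ih).1
  have hmono1 : ∀ N n, G N (s n) → G N (s (n + 1)) := by
    intro N n h
    rw [hsn]
    rcases (hnext _ (hgs n)).2.1 with h' | ⟨h', -⟩
    · exact hG N _ _ h' h
    · rw [h']; exact h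
  have hmono : ∀ N n m, n ≤ m → G N (s n) → G N (s m) := by
    intro N n m hnm h
    induction hnm with
    | refl => exact h
    | step _ ih => exact hmono1 _ _ ih
  refine ⟨s, hs0, ?_, ?_⟩
  · intro n
    rcases (hnext _ (hgs n)).2.1 with h' | ⟨h', hall⟩
    · left; rw [hsn]; exact h'
    · by_cases hst : Step (s n) (s (n + 1))
      · exact Or.inl hst
      right
      intro m hm
      induction hm with
      | refl => rfl
      | step _ ih => rw [hsn, ih, h']
  · have hprog : ∀ k N n, (∀ M < N, G M (s n)) → RR Step I G N k (s n) →
        ∃ m, n ≤ m ∧ G N (s m) := by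
      intro k
      induction k using Nat.strong_induction_on with
      | _ k ih =>
        intro N n h1 h2
        by_cases hg : G N (s n)
        · exact ⟨n, le_rfl, hg⟩
        obtain ⟨k', hk', h3⟩ := (hnext _ (hgs n)).2.2 N h1 hg k h2
        rw [← hsn] at h3
        obtain ⟨m, hm, hGm⟩ := ih k' hk' N (n + 1) (fun M hM => hmono1 _ _ (h1 M hM)) h3
        exact ⟨m, by omega, hGm⟩
    have hallN : ∀ N, ∃ n, ∀ M < N, G M (s n) := by
      intro N
      induction N with
      | zero => exact ⟨0, fun M h => absurd h (Nat.not_lt_zero M)⟩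
      | succ N ih =>
        obtain ⟨n, hn⟩ := ih
        obtain ⟨k, hk⟩ := hgood _ (hgs n) N
        obtain ⟨m, hm, hGm⟩ := hprog k N n hn hk
        refine ⟨m, fun M hM => ?_⟩
        rcases (Nat.lt_succ_iff.1 hM).eq_or_lt with h | h
        · rw [h]; exact hGm
        · exact hmono _ _ _ hm (hn M h)
    intro N
    obtain ⟨n, hn⟩ := hallN (N + 1)
    exact ⟨n, hn N (Nat.lt_succ_self N)⟩

/-- The fan arc `(b,x)`. -/
def fan (b x : ℤ) : ArcZ := ⟨b, max x (b + 2), le_max_right _ _⟩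

theorem fan_src (b x : ℤ) : (fan b x).src = b := rfl

theorem fan_tgt (b x : ℤ) (h : b + 2 ≤ x) : (fan b x).tgt = x := max_eq_left h

/-- The arc in slot `x`, given the status function `st`. -/
noncomputable def cur (b : ℤ) (α β : ℤ → ArcZ) (st : ℤ → ℕ) (x : ℤ) : ArcZ :=
  if st x = 0 then α x else if st x = 1 then fan b x else β x

/-- The set of arcs in state `st`. -/
def SS (T : Set ArcZ) (b : ℤ) (α β : ℤ → ArcZ) (st : ℤ → ℕ) : Set ArcZ :=
  {γ | (γ ∈ T ∧ γ.src < b) ∨ ∃ x, b + 2 ≤ x ∧ γ = cur b α β st x}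

/-- Valid states. -/
def VV (T : Set ArcZ) (b : ℤ) (α β : ℤ → ArcZ) (st : ℤ → ℕ) : Prop :=
  IsTriangulationZ (SS T b α β st) ∧
  (∀ x y, b + 2 ≤ x → b + 2 ≤ y → cur b α β st x = cur b α β st y → x = y) ∧
  (∀ x, b + 2 ≤ x → st x = 0 → α x ≠ fan b x)

/-- One flip, at slot `x`. -/
def StepAt (T : Set ArcZ) (b : ℤ) (α β : ℤ → ArcZ) (st st' : ℤ → ℕ) (x : ℤ) : Prop :=
  b + 2 ≤ x ∧ st x ≤ 1 ∧ st' = Function.update st x (st x + 1) ∧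
    Flip (SS T b α β st) (cur b α β st x) (cur b α β st' x)

def StepS (T : Set ArcZ) (b : ℤ) (α β : ℤ → ArcZ) (st st' : ℤ → ℕ) : Prop :=
  VV T b α β st ∧ ∃ x, StepAt T b α β st st' x

theorem cur_update_ne (b : ℤ) (α β : ℤ → ArcZ) (st : ℤ → ℕ) (x y : ℤ) (n : ℕ) (h : y ≠ x) :
    cur b α β (Function.update st x n) y = cur b α β st y := by
  simp [cur, Function.update_of_ne h]

theorem cur_src {T T' : Set ArcZ} {b : ℤ} {α β : ℤ → ArcZ}
    (hα : ∀ x, b + 2 ≤ x → IsA T b x (α x)) (hβ : ∀ x, b + 2 ≤ x → IsA T' b x (β x))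
    (st : ℤ → ℕ) (x : ℤ) (hx : b + 2 ≤ x) : b ≤ (cur b α β st x).src := by
  have h1 := (hα x hx).2
  have h2 := (hβ x hx).2
  unfold cur
  split_ifs
  · omega
  · exact le_rfl
  · omega

theorem step_set {T T' : Set ArcZ} {b : ℤ} {α β : ℤ → ArcZ}
    (hα : ∀ x, b + 2 ≤ x → IsA T b x (α x)) (hβ : ∀ x, b + 2 ≤ x → IsA T' b x (β x))
    {st st' : ℤ → ℕ} {x : ℤ} (hV : VV T b α β st) (h : StepAt T b α β st st' x) :
    SS T b α β st' = (SS T b α β st \ {cur b α β st x}) ∪ {cur b α β st' x} := by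
  obtain ⟨hx, -, rfl, hf⟩ := h
  ext γ
  constructor
  · rintro (h | ⟨y, hy, rfl⟩)
    · left
      refine ⟨Or.inl h, ?_⟩
      rintro rfl
      have := cur_src hα hβ st x hx
      omega
    · by_cases hyx : y = x
      · right; rw [hyx]; rfl
      · left
        rw [cur_update_ne _ _ _ _ _ _ _ hyx]
        exact ⟨Or.inr ⟨y, hy, rfl⟩, fun h => hyx (hV.2.1 y x hy hx h)⟩
  · rintro (⟨h | ⟨y, hy, rfl⟩, hne⟩ | h)
    · exact Or.inl h
    · have hyx : y ≠ x := by rintro rfl; exact hne rfl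
      exact Or.inr ⟨y, hy, (cur_update_ne _ _ _ _ _ _ _ hyx).symm⟩
    · exact Or.inr ⟨x, hx, h⟩

theorem step_valid {T T' : Set ArcZ} {b : ℤ} {α β : ℤ → ArcZ}
    (hα : ∀ x, b + 2 ≤ x → IsA T b x (α x)) (hβ : ∀ x, b + 2 ≤ x → IsA T' b x (β x))
    {st st' : ℤ → ℕ} {x : ℤ} (hV : VV T b α β st) (h : StepAt T b α β st st' x) :
    VV T b α β st' := by
  have hset := step_set hα hβ hV h
  obtain ⟨hx, h1, hst', hf⟩ := h
  have hnot := exch_not_mem hV.1 hf.1 hf.2.1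
  have hne : ∀ y, y ≠ x → cur b α β st' y = cur b α β st y := by
    intro y hy
    rw [hst', cur_update_ne _ _ _ _ _ _ _ hy]
  have hnew : ∀ y, b + 2 ≤ y → y ≠ x → cur b α β st' y ≠ cur b α β st' x := by
    intro y hy hyx he
    apply hnot
    rw [← he, hne y hyx]
    exact Or.inr ⟨y, hy, rfl⟩
  refine ⟨?_, ?_, ?_⟩
  · rw [hset]; exact hf.2.1.2
  · intro y z hy hz he
    by_cases hyx : y = x
    · by_cases hzx : z = x
      · rw [hyx, hzx]
      · exact absurd (he.symm.trans (by rw [hyx])) (hnew z hz hzx)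
    · by_cases hzx : z = x
      · exact absurd (he.trans (by rw [hzx])) (hnew y hy hyx)
      · rw [hne y hyx, hne z hzx] at he
        exact hV.2.1 y z hy hz he
  · intro y hy h0
    apply hV.2.2 y hy
    by_cases hyx : y = x
    · rw [hst', hyx, Function.update_self] at h0
      omega
    · rwa [hst', Function.update_of_ne hyx] at h0

theorem isA_cases {T : Set ArcZ} {b x : ℤ} (hx : b + 2 ≤ x) {γ : ArcZ} (h : IsA T b x γ)
    (hne : γ ≠ fan b x) :
    b < γ.src ∧ γ.src < x ∧ x < γ.tgt ∧ Edge T γ.src x ∧ Edge T x γ.tgt := by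
  rcases h.2 with h' | h'
  · exact absurd (arc_ext (by rw [h'.1, fan_src]) (by rw [h'.2, fan_tgt b x hx])) hne
  · exact h'

theorem mem_SS (T : Set ArcZ) (b : ℤ) (α β : ℤ → ArcZ) (st : ℤ → ℕ) (x : ℤ) (hx : b + 2 ≤ x) :
    cur b α β st x ∈ SS T b α β st := Or.inr ⟨x, hx, rfl⟩

theorem edge_fan {T : Set ArcZ} {b : ℤ} {α β : ℤ → ArcZ} {st : ℤ → ℕ} {x : ℤ} (hx : b + 2 ≤ x)
    (h : cur b α β st x = fan b x) : Edge (SS T b α β st) b x :=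
  Or.inr ⟨_, mem_SS T b α β st x hx, by rw [h, fan_src], by rw [h, fan_tgt b x hx]⟩

theorem claim1 {T T' : Set ArcZ} (hT : IsTriangulationZ T) {b : ℤ} {α β : ℤ → ArcZ}
    (hα : ∀ x, b + 2 ≤ x → IsA T b x (α x)) (hβ : ∀ x, b + 2 ≤ x → IsA T' b x (β x))
    (p q : ℤ) (hq1 : b + 1 ≤ q) (hp : Edge T b p) (n : ℕ) :
    ∀ st : ℤ → ℕ, VV T b α β st → (q = b + 1 ∨ cur b α β st q = fan b q) →
      (∀ x, q < x → x ≤ p → st x ≤ 1) →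
      ((Finset.Ioc q p).filter (fun x => st x = 0)).card = n →
      ∃ st', Relation.ReflTransGen (StepS T b α β) st st' ∧ VV T b α β st' ∧
        (∀ x, q < x → x ≤ p → st' x = 1) ∧ (∀ x, ¬ (q < x ∧ x ≤ p) → st' x = st x) := by
  induction n with
  | zero =>
    intro st hV hq hle hcard
    refine ⟨st, .refl, hV, ?_, fun _ _ => rfl⟩
    intro x h1 h2
    have h3 := hle x h1 h2
    rw [Finset.card_eq_zero] at hcard
    have h4 : st x ≠ 0 := by
      intro h0
      have : x ∈ (Finset.Ioc q p).filter (fun x => st x = 0) := by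
        simp [h0, h1, h2]
      rw [hcard] at this
      simp at this
    omega
  | succ n ih =>
    intro st hV hq hle hcard
    have hne : ((Finset.Ioc q p).filter (fun x => st x = 0)).Nonempty := by
      rw [← Finset.card_pos]; omega
    obtain ⟨x, hxm, hmax⟩ := Finset.exists_max_image _ (fun x => (α x).tgt - (α x).src) hne
    simp only [Finset.mem_filter, Finset.mem_Ioc] at hxm hmax
    obtain ⟨⟨hqx, hxp⟩, hx0⟩ := hxm
    have hx : b + 2 ≤ x := by omega
    have hcx : cur b α β st x = α x := by simp [cur, hx0]
    have hcf : ∀ y, st y = 1 → cur b α β st y = fan b y := by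
      intro y hy; simp [cur, hy]
    obtain ⟨a1, a2, a3, a4, a5⟩ := isA_cases hx (hα x hx) (hV.2.2 x hx hx0)
    have hmemS : α x ∈ SS T b α β st := by
      rw [← hcx]; exact mem_SS T b α β st x hx
    have hmemT : α x ∈ T := (hα x hx).1
    have eq : Edge (SS T b α β st) b q := by
      rcases hq with h | h
      · exact Or.inl h
      · by_cases h' : q = b + 1
        · exact Or.inl h'
        · exact edge_fan (by omega) h
    have n1 := edge_nc hV.1.1 eq hmemS
    have n2 := edge_nc hT.1 hp hmemT
    have hiq : q ≤ (α x).src := by omega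
    have hjp : (α x).tgt ≤ p := by omega
    -- edges from `b`
    have eb : ∀ y, q ≤ y → y ≤ p → (y = (α x).src ∨ y = (α x).tgt) →
        Edge (SS T b α β st) b y := by
      intro y h1 h2 h3
      rcases h1.eq_or_lt with h | h
      · rw [← h]; exact eq
      have hy : b + 2 ≤ y := by omega
      apply edge_fan hy
      apply hcf
      have := hle y h h2
      by_contra hy1
      have hy0 : st y = 0 := by omega
      obtain ⟨c1, c2, c3, c4, c5⟩ := isA_cases hy (hα y hy) (hV.2.2 y hy hy0)
      have := hT.1 _ hmemT _ (hα y hy).1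
      have := hmax y ⟨⟨h, h2⟩, hy0⟩
      unfold CrossZ at *
      omega
    -- lower edges
    have el : ∀ i j, (α x).src ≤ i → j ≤ (α x).tgt → Edge T i j → Edge (SS T b α β st) i j := by
      rintro i j h1 h2 (h | ⟨δ, hδ, rfl, rfl⟩)
      · exact Or.inl h
      · obtain ⟨y, hy, hA⟩ := isA_surj hT hδ (by omega : b ≤ δ.src)
        have hyd := isA_unique hT (hα y hy) hA
        have hA2 := hA.2
        have hst : st y = 0 := by
          have := hle y (by omega) (by omega)
          by_contra hy0
          have hy1 : st y = 1 := by omega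
          have hm := mem_SS T b α β st y hy
          have := hV.1.1 _ hmemS _ hm
          rw [hcf y hy1] at this
          unfold CrossZ at this
          rw [fan_src, fan_tgt b y hy] at this
          omega
        refine Or.inr ⟨δ, ?_, rfl, rfl⟩
        have hc : cur b α β st y = δ := by simp [cur, hst, hyd]
        rw [← hc]
        exact mem_SS T b α β st y hy
    let st1 := Function.update st x (st x + 1)
    have hc1 : cur b α β st1 x = fan b x := by simp [cur, st1, hx0]
    have hflip : Flip (SS T b α β st) (cur b α β st x) (cur b α β st1 x) := by
      rw [hc1, hcx]
      refine flip_of_quad hV.1 a1 a2 a3 (eb _ hiq (by omega) (Or.inl rfl))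
        (el _ _ le_rfl a3.le a4) (el _ _ a2.le le_rfl a5) (eb _ (by omega) hjp (Or.inr rfl))
        hmemS (Or.inr ⟨rfl, rfl, rfl, fan_tgt b x hx⟩)
    have hstep : StepAt T b α β st st1 x := ⟨hx, by omega, rfl, hflip⟩
    have hV1 := step_valid hα hβ hV hstep
    obtain ⟨st', r1, r2, r3, r4⟩ := ih st1 hV1
      (by
        rcases hq with h | h
        · exact Or.inl h
        · right
          rw [← h]
          exact cur_update_ne _ _ _ _ _ _ _ (by omega))
      (by
        intro y h1 h2
        by_cases hyx : y = x
        · simp [st1, hyx, hx0]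
        · simp only [st1, Function.update_of_ne hyx]
          exact hle y h1 h2)
      (by
        have : (Finset.Ioc q p).filter (fun y => st1 y = 0) =
            ((Finset.Ioc q p).filter (fun y => st y = 0)).erase x := by
          ext y
          simp only [Finset.mem_filter, Finset.mem_Ioc, Finset.mem_erase]
          by_cases hyx : y = x
          · simp [st1, hyx]
          · simp [st1, Function.update_of_ne hyx, hyx]
        rw [this, Finset.card_erase_of_mem, hcard]
        · rfl
        · simp [hqx, hxp, hx0])
    refine ⟨st', .head ⟨hV, x, hstep⟩ r1, r2, r3, ?_⟩
    intro y hy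
    rw [r4 y hy]
    have hyx : y ≠ x := by rintro rfl; exact hy ⟨hqx, hxp⟩
    simp [st1, Function.update_of_ne hyx]

/-- Slot `x` is in its final state. -/
def Done (b : ℤ) (β : ℤ → ArcZ) (st : ℤ → ℕ) (x : ℤ) : Prop :=
  st x = 2 ∨ (st x = 1 ∧ β x = fan b x)

theorem cur_done {b : ℤ} {α β : ℤ → ArcZ} {st : ℤ → ℕ} {x : ℤ} (h : Done b β st x) :
    cur b α β st x = β x := by
  rcases h with h | ⟨h, h'⟩
  · simp [cur, h]
  · simp [cur, h, h']

theorem claim2 {T T' : Set ArcZ} (hT' : IsTriangulationZ T') {b : ℤ} {α β : ℤ → ArcZ}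
    (hα : ∀ x, b + 2 ≤ x → IsA T b x (α x)) (hβ : ∀ x, b + 2 ≤ x → IsA T' b x (β x))
    (q : ℤ) (hq : Edge T' b q) (n : ℕ) :
    ∀ st : ℤ → ℕ, VV T b α β st →
      (∀ x, b + 2 ≤ x → x ≤ q → st x = 1 ∨ st x = 2) →
      ((Finset.Icc (b + 2) q).filter (fun x => ¬ Done b β st x)).card = n →
      ∃ st', Relation.ReflTransGen (StepS T b α β) st st' ∧ VV T b α β st' ∧
        (∀ x, b + 2 ≤ x → x ≤ q → Done b β st' x) ∧
        (∀ x, q < x → st' x = st x) := by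
  induction n with
  | zero =>
    intro st hV hle hcard
    refine ⟨st, .refl, hV, ?_, fun _ _ => rfl⟩
    intro x h1 h2
    rw [Finset.card_eq_zero] at hcard
    by_contra h0
    have : x ∈ (Finset.Icc (b + 2) q).filter (fun x => ¬ Done b β st x) := by
      simp [h0, h1, h2]
    rw [hcard] at this
    simp at this
  | succ n ih =>
    intro st hV hle hcard
    have hne : ((Finset.Icc (b + 2) q).filter (fun x => ¬ Done b β st x)).Nonempty := by
      rw [← Finset.card_pos]; omega
    obtain ⟨x, hxm, hmin⟩ := Finset.exists_min_image _ (fun x => (β x).tgt - (β x).src) hne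
    simp only [Finset.mem_filter, Finset.mem_Icc] at hxm hmin
    obtain ⟨⟨hx, hxq⟩, hxd⟩ := hxm
    have hx1 : st x = 1 := by
      rcases hle x hx hxq with h | h
      · exact h
      · exact absurd (Or.inl h) hxd
    have hβf : β x ≠ fan b x := fun h => hxd (Or.inr ⟨hx1, h⟩)
    have hcf : ∀ y, st y = 1 → cur b α β st y = fan b y := by
      intro y hy; simp [cur, hy]
    have hcx := hcf x hx1
    obtain ⟨a1, a2, a3, a4, a5⟩ := isA_cases hx (hβ x hx) hβf
    have hmemS : fan b x ∈ SS T b α β st := by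
      rw [← hcx]; exact mem_SS T b α β st x hx
    have hmemT : β x ∈ T' := (hβ x hx).1
    have n2 := edge_nc hT'.1 hq hmemT
    have hjq : (β x).tgt ≤ q := by omega
    have eb : ∀ y, b + 1 ≤ y → y ≤ q → (y = (β x).src ∨ y = (β x).tgt) →
        Edge (SS T b α β st) b y := by
      intro y h1 h2 h3
      rcases h1.eq_or_lt with h | h
      · exact Or.inl h.symm
      have hy : b + 2 ≤ y := by omega
      apply edge_fan hy
      rcases hle y hy h2 with hs | hs
      · exact hcf y hs
      · have hcy : cur b α β st y = β y := by simp [cur, hs]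
        rw [hcy]
        by_contra hyf
        obtain ⟨c1, c2, c3, c4, c5⟩ := isA_cases hy (hβ y hy) hyf
        have k1 := hT'.1 _ hmemT _ (hβ y hy).1
        have hm := mem_SS T b α β st y hy
        rw [hcy] at hm
        have k2 := hV.1.1 _ hmemS _ hm
        unfold CrossZ at k1 k2
        rw [fan_src, fan_tgt b x hx] at k2
        omega
    have el : ∀ i j, (β x).src ≤ i → j ≤ (β x).tgt → j - i < (β x).tgt - (β x).src →
        Edge T' i j → Edge (SS T b α β st) i j := by
      rintro i j h1 h2 h3 (h | ⟨δ, hδ, rfl, rfl⟩)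
      · exact Or.inl h
      · obtain ⟨y, hy, hA⟩ := isA_surj hT' hδ (by omega : b ≤ δ.src)
        have hyd := isA_unique hT' (hβ y hy) hA
        have hA2 := hA.2
        have hst : Done b β st y := by
          by_contra hnd
          have := hmin y ⟨⟨hy, by omega⟩, hnd⟩
          rw [hyd] at this
          omega
        refine Or.inr ⟨δ, ?_, rfl, rfl⟩
        rw [← hyd, ← cur_done (α := α) hst]
        exact mem_SS T b α β st y hy
    let st1 := Function.update st x (st x + 1)
    have hc1 : cur b α β st1 x = β x := by simp [cur, st1, hx1]
    have hflip : Flip (SS T b α β st) (cur b α β st x) (cur b α β st1 x) := by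
      rw [hc1, hcx]
      refine flip_of_quad hV.1 a1 a2 a3 (eb _ (by omega) (by omega) (Or.inl rfl))
        (el _ _ le_rfl a3.le (by omega) a4) (el _ _ a2.le le_rfl (by omega) a5)
        (eb _ (by omega) hjq (Or.inr rfl))
        hmemS (Or.inl ⟨rfl, fan_tgt b x hx, rfl, rfl⟩)
    have hstep : StepAt T b α β st st1 x := ⟨hx, by omega, rfl, hflip⟩
    have hV1 := step_valid hα hβ hV hstep
    obtain ⟨st', r1, r2, r3, r4⟩ := ih st1 hV1
      (by
        intro y h1 h2
        by_cases hyx : y = x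
        · simp [st1, hyx, hx1]
        · simp only [st1, Function.update_of_ne hyx]
          exact hle y h1 h2)
      (by
        have : (Finset.Icc (b + 2) q).filter (fun y => ¬ Done b β st1 y) =
            ((Finset.Icc (b + 2) q).filter (fun y => ¬ Done b β st y)).erase x := by
          ext y
          simp only [Finset.mem_filter, Finset.mem_Icc, Finset.mem_erase]
          by_cases hyx : y = x
          · simp [st1, hyx, Done, hx1]
          · simp [st1, Done, Function.update_of_ne hyx, hyx]
        rw [this, Finset.card_erase_of_mem, hcard]
        · rfl
        · simp [hx, hxq, hxd])
    refine ⟨st', .head ⟨hV, x, hstep⟩ r1, r2, r3, ?_⟩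
    intro y hy
    rw [r4 y hy]
    have hyx : y ≠ x := by omega
    simp [st1, Function.update_of_ne hyx]

/-- Macro states. -/
def Macro (T T' : Set ArcZ) (b : ℤ) (α β : ℤ → ArcZ) (st : ℤ → ℕ) : Prop :=
  VV T b α β st ∧ ∃ q, b + 1 ≤ q ∧ Edge T' b q ∧
    (∀ x, b + 2 ≤ x → x ≤ q → Done b β st x) ∧ ∀ x, q < x → st x ≤ 1

def Goal (b : ℤ) (β : ℤ → ArcZ) (N : ℕ) (st : ℤ → ℕ) : Prop :=
  ∀ x, b + 2 ≤ x → x ≤ b + N → Done b β st x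

theorem macro_step {T T' : Set ArcZ} (hT : IsTriangulationZ T) (hT' : IsTriangulationZ T')
    {b : ℤ} (hb : RightFountainZ T b) (hb' : RightFountainZ T' b) {α β : ℤ → ArcZ}
    (hα : ∀ x, b + 2 ≤ x → IsA T b x (α x)) (hβ : ∀ x, b + 2 ≤ x → IsA T' b x (β x))
    (st : ℤ → ℕ) (h : Macro T T' b α β st) (N : ℕ) :
    ∃ t, Relation.ReflTransGen (StepS T b α β) st t ∧ Macro T T' b α β t ∧ Goal b β N t := by
  obtain ⟨hV, q, hq1, hqe, hqd, hq2⟩ := h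
  obtain ⟨δ', hδ', d1, d2⟩ := fountain_large hb' (max q (b + N))
  obtain ⟨δ, hδ, d3, d4⟩ := fountain_large hb δ'.tgt
  have hqf : q = b + 1 ∨ cur b α β st q = fan b q := by
    by_cases h : q = b + 1
    · exact Or.inl h
    right
    rw [cur_done (hqd q (by omega) le_rfl)]
    by_contra hne
    obtain ⟨c1, c2, c3, c4, c5⟩ := isA_cases (by omega) (hβ q (by omega)) hne
    have := edge_nc hT'.1 hqe (hβ q (by omega)).1
    omega
  obtain ⟨s1, r1, r2, r3, r4⟩ := claim1 hT hα hβ δ.tgt q hq1 (Or.inr ⟨δ, hδ, d3, rfl⟩) _ st hV hqf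
    (fun x h _ => hq2 x h) rfl
  obtain ⟨s2, u1, u2, u3, u4⟩ := claim2 hT' hα hβ δ'.tgt (Or.inr ⟨δ', hδ', d1, rfl⟩) _ s1 r2
    (by
      intro x h1 h2
      by_cases hxq : x ≤ q
      · rw [r4 x (by omega)]
        rcases hqd x h1 hxq with h | h
        · exact Or.inr h
        · exact Or.inl h.1
      · exact Or.inl (r3 x (by omega) (by omega))) rfl
  refine ⟨s2, r1.trans u1, ⟨u2, δ'.tgt, by omega, Or.inr ⟨δ', hδ', d1, rfl⟩, u3, ?_⟩, ?_⟩
  · intro x hx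
    rw [u4 x hx]
    by_cases hxp : x ≤ δ.tgt
    · rw [r3 x (by omega) hxp]
    · rw [r4 x (by omega)]
      exact hq2 x (by omega)
  · intro x h1 h2
    exact u3 x h1 (by omega)

theorem done_step {T : Set ArcZ} {b : ℤ} {α β : ℤ → ArcZ} {s t : ℤ → ℕ}
    (h : StepS T b α β s t) (x : ℤ) (hd : Done b β s x) : Done b β t x := by
  obtain ⟨hV, y, hy, h1, rfl, hf⟩ := h
  by_cases hxy : x = y
  · exfalso
    subst hxy
    rcases hd with hd | ⟨hd, hd'⟩
    · omega
    · apply hf.2.1.1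
      simp [cur, hd, hd']
  · simpa [Done, Function.update_of_ne hxy] using hd

end Infgon

open Infgon

/-- If `T` and `T'` both have a right fountain at `b`, then there is a `T`-admissible
sequence `θ` with `μ_θ(T)|_{[b,∞)} = T'|_{[b,∞)}` leaving every arc of `T \ T|_{[b,∞)}`
untouched. -/
theorem statement13 (T T' : Set ArcZ) (hT : IsTriangulationZ T) (hT' : IsTriangulationZ T')
    (b : ℤ) (hb : RightFountainZ T b) (hb' : RightFountainZ T' b) :
    ∃ θ : ℕ → Option ArcZ, AdmissibleZ T θ ∧
      restrictZ (mutSeqZ T θ) (Set.Ici b) = restrictZ T' (Set.Ici b) ∧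
      ∀ γ ∈ T, γ ∉ restrictZ T (Set.Ici b) → UntouchedZ T θ γ := by
  have : Nonempty ArcZ := ⟨⟨0, 2, by norm_num⟩⟩
  choose! α hα using exists_isA hT hb
  choose! β hβ using exists_isA hT' hb'
  let st0 : ℤ → ℕ := fun x => if α x = fan b x then 1 else 0
  have hc0 : ∀ x, cur b α β st0 x = α x := by
    intro x
    by_cases h : α x = fan b x <;> simp [cur, st0, h]
  have hS0 : SS T b α β st0 = T := by
    ext γ
    constructor
    · rintro (h | ⟨x, hx, rfl⟩)
      · exact h.1
      · rw [hc0]; exact (hα x hx).1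
    · intro h
      by_cases hs : γ.src < b
      · exact Or.inl ⟨h, hs⟩
      · obtain ⟨x, hx, hA⟩ := isA_surj hT h (not_lt.1 hs)
        exact Or.inr ⟨x, hx, by rw [hc0]; exact isA_unique hT hA (hα x hx)⟩
  have hV0 : VV T b α β st0 := by
    refine ⟨by rw [hS0]; exact hT, ?_, ?_⟩
    · intro x y hx hy he
      rw [hc0, hc0] at he
      have h1 := hα x hx
      rw [he] at h1
      exact isA_inj hT h1 (hα y hy)
    · intro x hx h0 he
      simp [st0, he] at h0
  have hM0 : Macro T T' b α β st0 := by
    refine ⟨hV0, b + 1, le_rfl, Or.inl rfl, fun x h1 h2 => by omega, ?_⟩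
    intro x _
    simp only [st0]
    split_ifs <;> simp
  obtain ⟨s, hs0, hs, hG⟩ := seq_exists (StepS T b α β) (Macro T T' b α β) (Goal b β)
    (fun N s t hst h x h1 h2 => done_step hst x (h x h1 h2))
    (fun s h N => macro_step hT hT' hb hb' hα hβ s h N) st0 hM0
  let θ : ℕ → Option ArcZ := fun n =>
    if h : StepS T b α β (s n) (s (n + 1)) then some (cur b α β (s n) h.2.choose) else none
  have hsome : ∀ n, StepS T b α β (s n) (s (n + 1)) → VV T b α β (s n) ∧
      ∃ x, StepAt T b α β (s n) (s (n + 1)) x ∧ θ n = some (cur b α β (s n) x) := by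
    intro n h
    refine ⟨h.1, h.2.choose, h.2.choose_spec, ?_⟩
    simp only [θ]
    rw [dif_pos h]
  have hnone : ∀ n, ¬ StepS T b α β (s n) (s (n + 1)) →
      θ n = none ∧ ∀ m, n ≤ m → s m = s n := by
    intro n h
    refine ⟨?_, (hs n).resolve_left h⟩
    simp only [θ]
    rw [dif_neg h]
  have hirr : ∀ t, ¬ StepS T b α β t t := by
    rintro t ⟨_, x, -, -, -, hf⟩
    exact hf.2.1.1 rfl
  have hT_iter : ∀ n, iterTZ T θ n = SS T b α β (s n) := by
    intro n
    induction n with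
    | zero => rw [hs0, hS0]; rfl
    | succ n ih =>
      show stepTZ (iterTZ T θ n) (θ n) = _
      rw [ih]
      by_cases h : StepS T b α β (s n) (s (n + 1))
      · obtain ⟨hV, x, hx, hθ⟩ := hsome n h
        rw [hθ, step_set hα hβ hV hx]
        simp only [stepTZ, mutateZ]
        rw [flipArc_eq hx.2.2.2]
      · obtain ⟨h1, h2⟩ := hnone n h
        rw [h1, h2 (n + 1) (by omega)]
        rfl
  have hA_old : ∀ γ ∈ T, γ.src < b → ∀ n, iterAZ T θ γ n = γ := by
    intro γ hγ hsrc n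
    induction n with
    | zero => rfl
    | succ n ih =>
      show stepAZ (iterTZ T θ n) (θ n) (iterAZ T θ γ n) = _
      rw [ih]
      by_cases h : StepS T b α β (s n) (s (n + 1))
      · obtain ⟨hV, x, hx, hθ⟩ := hsome n h
        rw [hθ]
        simp only [stepAZ, mutArcZ]
        rw [if_neg]
        rintro rfl
        have := cur_src hα hβ (s n) x hx.1
        omega
      · rw [(hnone n h).1]
        rfl
  have hA_new : ∀ x, b + 2 ≤ x → ∀ n, iterAZ T θ (α x) n = cur b α β (s n) x := by
    intro x hx n
    induction n with
    | zero => rw [hs0, hc0]; rfl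
    | succ n ih =>
      show stepAZ (iterTZ T θ n) (θ n) (iterAZ T θ (α x) n) = _
      rw [ih, hT_iter]
      by_cases h : StepS T b α β (s n) (s (n + 1))
      · obtain ⟨hV, y, hy, hθ⟩ := hsome n h
        rw [hθ]
        simp only [stepAZ, mutArcZ]
        by_cases hxy : x = y
        · rw [hxy, if_pos rfl, flipArc_eq hy.2.2.2]
        · rw [if_neg (fun h => hxy (hV.2.1 x y hx hy.1 h)), hy.2.2.1,
            cur_update_ne _ _ _ _ _ _ _ hxy]
      · obtain ⟨h1, h2⟩ := hnone n h
        rw [h1, h2 (n + 1) (by omega)]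
        rfl
  have hdone : ∀ x, b + 2 ≤ x → ∃ n, ∀ m, n ≤ m → Done b β (s m) x := by
    intro x hx
    obtain ⟨n, hn⟩ := hG (x - b).toNat
    refine ⟨n, fun m hm => ?_⟩
    induction hm with
    | refl => exact hn x hx (by omega)
    | @step m hm ih =>
      by_cases h : StepS T b α β (s m) (s (m + 1))
      · exact done_step h x ih
      · have := (hnone m h).2 (m + 1) (by omega)
        show Done b β (s (m + 1)) x
        rw [this]; exact ih
  have hstab : ∀ x, b + 2 ≤ x → ∃ l, ∀ k, l ≤ k → iterAZ T θ (α x) k = β x := by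
    intro x hx
    obtain ⟨l, hl⟩ := hdone x hx
    exact ⟨l, fun k hk => by rw [hA_new x hx, cur_done (hl k hk)]⟩
  have hcls : ∀ γ ∈ T, γ.src < b ∨ ∃ x, b + 2 ≤ x ∧ γ = α x := by
    intro γ hγ
    by_cases hsrc : γ.src < b
    · exact Or.inl hsrc
    · obtain ⟨x, hx, hA⟩ := isA_surj hT hγ (not_lt.1 hsrc)
      exact Or.inr ⟨x, hx, isA_unique hT hA (hα x hx)⟩
  have hlim_new : ∀ x, b + 2 ≤ x → seqLimitZ T θ (α x) = β x := by
    intro x hx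
    obtain ⟨l, hl⟩ := hstab x hx
    have hex : ∃ l, ∀ k, l ≤ k → iterAZ T θ (α x) k = iterAZ T θ (α x) l :=
      ⟨l, fun k hk => by rw [hl k hk, hl l le_rfl]⟩
    unfold seqLimitZ
    rw [dif_pos hex]
    have h1 := hex.choose_spec (max l hex.choose) (le_max_right _ _)
    rw [← h1, hl _ (le_max_left _ _)]
  have hlim_old : ∀ γ ∈ T, γ.src < b → seqLimitZ T θ γ = γ := by
    intro γ hγ hsrc
    unfold seqLimitZ
    split_ifs with h
    · exact hA_old γ hγ hsrc _
    · rfl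
  refine ⟨θ, ⟨?_, ?_, ?_⟩, ?_, ?_⟩
  · intro i hi
    by_cases h : StepS T b α β (s i) (s (i + 1))
    · obtain ⟨_, x, _, hθ⟩ := hsome i h
      rw [hθ] at hi
      cases hi
    · have h2 := (hnone i h).2
      apply (hnone (i + 1) _).1
      rw [h2 (i + 1) (by omega), h2 (i + 1 + 1) (by omega)]
      exact hirr _
  · intro i γ hi
    by_cases h : StepS T b α β (s i) (s (i + 1))
    · obtain ⟨_, x, hx, hθ⟩ := hsome i h
      rw [hθ] at hi
      cases hi
      rw [hT_iter]
      exact ⟨hx.2.2.2.1, _, hx.2.2.2.2.1⟩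
    · rw [(hnone i h).1] at hi
      cases hi
  · intro γ hγ
    rcases hcls γ hγ with h | ⟨x, hx, rfl⟩
    · exact ⟨0, fun k _ => by rw [hA_old γ hγ h, hA_old γ hγ h]⟩
    · obtain ⟨l, hl⟩ := hstab x hx
      exact ⟨l, fun k hk => by rw [hl k hk, hl l le_rfl]⟩
  · ext γ
    constructor
    · rintro ⟨⟨δ, hδ, rfl⟩, h1, h2⟩
      rcases hcls δ hδ with h | ⟨x, hx, rfl⟩
      · rw [hlim_old δ hδ h] at h1
        exact absurd h1 (not_le.2 h)
      · refine ⟨?_, h1, h2⟩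
        rw [hlim_new x hx]
        exact (hβ x hx).1
    · rintro ⟨h, h1, h2⟩
      refine ⟨?_, h1, h2⟩
      obtain ⟨x, hx, hA⟩ := isA_surj hT' h h1
      exact ⟨α x, (hα x hx).1, by rw [hlim_new x hx]; exact isA_unique hT' (hβ x hx) hA⟩
  · intro γ hγ hn l
    apply hA_old γ hγ
    by_contra hsrc
    apply hn
    have := γ.sep
    exact ⟨hγ, not_lt.1 hsrc, by rw [Set.mem_Ici]; omega⟩
end

section
/- Two triangulations T and T′ of the ∞-gon are strongly mutation equivalent if and only if either both are locally finite, or there exist a, b ∈ ℤ with a ≤ b such that both T and T′ have a left fountain at a and a right fountain at b. -/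
open scoped Classical

/-! ### Elementary facts -/

theorem ArcZ_ext' {x y : ArcZ} (h1 : x.src = y.src) (h2 : x.tgt = y.tgt) : x = y := by
  cases x; cases y; simp_all

theorem ArcZ_inj : Function.Injective (fun x : ArcZ => (x.src, x.tgt)) := by
  intro x y h
  simp only [Prod.mk.injEq] at h
  exact ArcZ_ext' h.1 h.2

instance ArcZ_countable : Countable ArcZ := ArcZ_inj.countable

/-- `x` lies weakly under `C`. -/
def UnderZ (x C : ArcZ) : Prop := C.src ≤ x.src ∧ x.tgt ≤ C.tgt

theorem under_finite (C : ArcZ) : {x : ArcZ | UnderZ x C}.Finite := by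
  have h : (Set.Icc C.src C.tgt ×ˢ Set.Icc C.src C.tgt).Finite :=
    (Set.finite_Icc _ _).prod (Set.finite_Icc _ _)
  refine (h.preimage ArcZ_inj.injOn).subset ?_
  intro x hx
  have := x.sep
  simp only [UnderZ, Set.mem_ofPred_eq] at hx
  simp only [Set.mem_preimage, Set.mem_prod, Set.mem_Icc]
  omega

theorem cross_symm {x y : ArcZ} (h : CrossZ x y) : CrossZ y x := by
  unfold CrossZ at *; omega

theorem not_cross_self (x : ArcZ) : ¬ CrossZ x x := by
  unfold CrossZ; omega

/-- The pair `(p,q)` is a boundary edge or an arc of `S`. -/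
def EdgeZ (S : Set ArcZ) (p q : ℤ) : Prop :=
  q = p + 1 ∨ ∃ x ∈ S, x.src = p ∧ x.tgt = q

theorem edge_lt {S : Set ArcZ} {p q : ℤ} (h : EdgeZ S p q) : p < q := by
  rcases h with h | ⟨x, _, h1, h2⟩
  · omega
  · have := x.sep; omega

theorem edge_nc {S : Set ArcZ} {p q : ℤ} (h : EdgeZ S p q) {y : ArcZ}
    (hy : ∀ x ∈ S, x.src = p → x.tgt = q → ¬ CrossZ y x) :
    ¬ ((y.src < p ∧ p < y.tgt ∧ y.tgt < q) ∨ (p < y.src ∧ y.src < q ∧ q < y.tgt)) := by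
  rcases h with h | ⟨x, hx, h1, h2⟩
  · omega
  · have := hy x hx h1 h2
    unfold CrossZ at this
    rw [h1, h2] at this
    exact this

theorem edge_nc' {S : Set ArcZ} (hS : IsTriangulationZ S) {p q : ℤ} (h : EdgeZ S p q) {y : ArcZ}
    (hy : y ∈ S) :
    ¬ ((y.src < p ∧ p < y.tgt ∧ y.tgt < q) ∨ (p < y.src ∧ y.src < q ∧ q < y.tgt)) :=
  edge_nc h fun x hx _ _ => hS.1 y hy x hx

/-- Maximality in terms of edges. -/
theorem edge_of_nc {S : Set ArcZ} (hS : IsTriangulationZ S) {p q : ℤ} (hpq : p < q)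
    (h : ∀ y ∈ S, ¬ ((y.src < p ∧ p < y.tgt ∧ y.tgt < q) ∨ (p < y.src ∧ y.src < q ∧ q < y.tgt))) :
    EdgeZ S p q := by
  by_cases h2 : q = p + 1
  · exact Or.inl h2
  · right
    refine ⟨⟨p, q, by omega⟩, ?_, rfl, rfl⟩
    apply hS.2
    intro x hx hc
    apply h x hx
    unfold CrossZ at hc
    simp only at hc
    omega

theorem edge_mem {S : Set ArcZ} {p q : ℤ} (h : EdgeZ S p q) (h2 : p + 2 ≤ q) :
    (⟨p, q, h2⟩ : ArcZ) ∈ S := by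
  rcases h with h | ⟨x, hx, h1, h3⟩
  · omega
  · have : x = ⟨p, q, h2⟩ := ArcZ_ext' h1 h3
    rwa [← this]

/-- An integer set, bounded above and nonempty, has a maximum. -/
theorem exists_max_int {P : ℤ → Prop} (B : ℤ) (hB : ∀ z, P z → z ≤ B) (z₀ : ℤ) (h0 : P z₀) :
    ∃ m, P m ∧ ∀ z, P z → z ≤ m :=
  Int.exists_greatest_of_bdd ⟨B, hB⟩ ⟨z₀, h0⟩

theorem exists_min_int {P : ℤ → Prop} (B : ℤ) (hB : ∀ z, P z → B ≤ z) (z₀ : ℤ) (h0 : P z₀) :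
    ∃ m, P m ∧ ∀ z, P z → m ≤ z :=
  Int.exists_least_of_bdd ⟨B, hB⟩ ⟨z₀, h0⟩

theorem triangle_below {S : Set ArcZ} (hS : IsTriangulationZ S) {x : ArcZ} (hx : x ∈ S) :
    ∃ s, x.src < s ∧ s < x.tgt ∧ EdgeZ S x.src s ∧ EdgeZ S s x.tgt := by
  have hsep := x.sep
  obtain ⟨s, ⟨hs1, hs2⟩, hmax⟩ := exists_max_int (P := fun s => EdgeZ S x.src s ∧ s < x.tgt)
    x.tgt (fun z hz => hz.2.le) (x.src + 1) ⟨Or.inl rfl, by omega⟩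
  have hlt := edge_lt hs1
  refine ⟨s, hlt, hs2, hs1, edge_of_nc hS hs2 ?_⟩
  intro y hy hc
  have h1 := hS.1 y hy x hx
  have h2 := edge_nc' hS hs1 hy
  unfold CrossZ at h1
  have h3 : y.src = x.src := by omega
  have h4 := hmax y.tgt ⟨Or.inr ⟨y, hy, h3, rfl⟩, by omega⟩
  omega

theorem triangle_above {S : Set ArcZ} (hS : IsTriangulationZ S) {x C : ArcZ} (hx : x ∈ S)
    (hC : C ∈ S) (hu : UnderZ x C) (hne : x ≠ C) :
    (∃ r, r < x.src ∧ EdgeZ S r x.src ∧ EdgeZ S r x.tgt) ∨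
    (∃ r, x.tgt < r ∧ EdgeZ S x.src r ∧ EdgeZ S x.tgt r) := by
  have hfin : {D : ArcZ | D ∈ S ∧ UnderZ x D ∧ x ≠ D ∧ UnderZ D C}.Finite :=
    (under_finite C).subset fun D hD => hD.2.2.2
  obtain ⟨D, ⟨hD, hxD, hne', hDC⟩, hmin⟩ := Set.exists_min_image _ (fun D : ArcZ => D.tgt - D.src)
    hfin ⟨C, hC, hu, hne, le_refl _, le_refl _⟩
  obtain ⟨s, hs1, hs2, e1, e2⟩ := triangle_below hS hD
  have hne2 : ¬ (x.src = D.src ∧ x.tgt = D.tgt) := fun h => hne' (ArcZ_ext' h.1 h.2)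
  have n1 := edge_nc' hS e1 hx
  have n2 := edge_nc' hS e2 hx
  have hsx := x.sep
  have key : ∀ p q, EdgeZ S p q → D.src ≤ p → q ≤ D.tgt → q - p < D.tgt - D.src →
      p ≤ x.src → x.tgt ≤ q → p = x.src ∧ q = x.tgt := by
    intro p q he h1 h2 h3 h4 h5
    by_contra hcon
    have hm := edge_mem he (by omega)
    have := hmin ⟨p, q, by omega⟩ ⟨hm, ⟨h4, h5⟩, ?_, ?_⟩
    · simp only at this; omega
    · intro h; apply hcon; rw [h]; exact ⟨rfl, rfl⟩
    · unfold UnderZ at *; simp only; omega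
  unfold UnderZ at hxD
  have eD : EdgeZ S D.src D.tgt := Or.inr ⟨D, hD, rfl, rfl⟩
  rcases le_or_gt s x.src with h | h
  · obtain ⟨h1, h2⟩ := key s D.tgt e2 (by omega) (by omega) (by omega) h hxD.2
    left
    exact ⟨D.src, by omega, by rwa [h1] at e1, by rwa [h2] at eD⟩
  · rcases le_or_gt x.tgt s with h' | h'
    · obtain ⟨h1, h2⟩ := key D.src s e1 (by omega) (by omega) (by omega) hxD.1 h'
      right
      exact ⟨D.tgt, by omega, by rwa [h1] at eD, by rwa [h2] at e2⟩
    · omega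

/-! ### Mutations -/

theorem mutable_tri {S : Set ArcZ} {x : ArcZ} (h : IsMutableZ S x) :
    IsTriangulationZ (mutateZ S x) := by
  have h2 := h.2
  unfold mutateZ flipArcZ
  rw [dif_pos h2]
  exact h2.choose_spec.2

theorem mutable_flip_ne {S : Set ArcZ} {x : ArcZ} (h : IsMutableZ S x) : flipArcZ S x ≠ x := by
  have h2 := h.2
  unfold flipArcZ
  rw [dif_pos h2]
  exact h2.choose_spec.1

theorem mutable_cross {S : Set ArcZ} (hS : IsTriangulationZ S) {x : ArcZ} (h : IsMutableZ S x) :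
    CrossZ (flipArcZ S x) x := by
  by_contra hc
  have hT := mutable_tri h
  have : x ∈ mutateZ S x := by
    apply hT.2
    rintro y (hy | hy)
    · exact hS.1 x h.1 y hy.1
    · rw [Set.mem_singleton_iff] at hy
      subst hy
      exact fun h => hc (cross_symm h)
  rcases this with h1 | h1
  · exact h1.2 rfl
  · exact mutable_flip_ne h h1.symm

theorem mutable_of {S : Set ArcZ} (hS : IsTriangulationZ S) {x x' : ArcZ} (hx : x ∈ S)
    (hc : CrossZ x' x)
    (hu : ∀ d, (∀ y ∈ S, y ≠ x → ¬ CrossZ d y) → CrossZ d x → d = x')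
    (hu' : ∀ d ∈ S, CrossZ d x' → d = x) :
    IsMutableZ S x ∧ flipArcZ S x = x' := by
  have hne : x' ≠ x := by rintro rfl; exact not_cross_self _ hc
  have hm : IsMutableZ S x := by
    refine ⟨hx, x', hne, ?_, ?_⟩
    · rintro y (hy | hy) z (hz | hz)
      · exact hS.1 y hy.1 z hz.1
      · rw [Set.mem_singleton_iff] at hz
        subst hz
        exact fun h => hy.2 (hu' y hy.1 h)
      · rw [Set.mem_singleton_iff] at hy
        subst hy
        exact fun h => hz.2 (hu' z hz.1 (cross_symm h))
      · rw [Set.mem_singleton_iff] at hy hz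
        subst hy; subst hz
        exact not_cross_self _
    · intro d hd
      by_cases hdx : CrossZ d x
      · right
        exact hu d (fun y hy hyx => hd y (Or.inl ⟨hy, hyx⟩)) hdx
      · left
        refine ⟨hS.2 d ?_, ?_⟩
        · intro y hy
          by_cases hyx : y = x
          · rwa [hyx]
          · exact hd y (Or.inl ⟨hy, hyx⟩)
        · intro h
          rw [Set.mem_singleton_iff] at h
          subst h
          exact hd x' (Or.inr rfl) (cross_symm hc)
  refine ⟨hm, hu _ ?_ (mutable_cross hS hm)⟩
  intro y hy hyx
  exact (mutable_tri hm).1 _ (Or.inr rfl) y (Or.inl ⟨hy, hyx⟩)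

theorem quad_arith {a b c d i j : ℤ} (hab : a < b) (hbc : b < c) (hcd : c < d) (hij : i < j)
    (h1 : ¬ ((i < a ∧ a < j ∧ j < b) ∨ (a < i ∧ i < b ∧ b < j)))
    (h2 : ¬ ((i < b ∧ b < j ∧ j < c) ∨ (b < i ∧ i < c ∧ c < j)))
    (h3 : ¬ ((i < c ∧ c < j ∧ j < d) ∨ (c < i ∧ i < d ∧ d < j)))
    (h4 : ¬ ((i < a ∧ a < j ∧ j < d) ∨ (a < i ∧ i < d ∧ d < j))) :
    (((i < a ∧ a < j ∧ j < c) ∨ (a < i ∧ i < c ∧ c < j)) → i = b ∧ j = d) ∧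
    (((i < b ∧ b < j ∧ j < d) ∨ (b < i ∧ i < d ∧ d < j)) → i = a ∧ j = c) := by
  constructor
  · rintro (h | h)
    · omega
    · omega
  · rintro (h | h)
    · omega
    · omega

theorem mutable_quad13 {S : Set ArcZ} (hS : IsTriangulationZ S) {x x' : ArcZ} (hx : x ∈ S)
    (h12 : x.src < x'.src) (h23 : x'.src < x.tgt) (h34 : x.tgt < x'.tgt)
    (e12 : EdgeZ S x.src x'.src) (e23 : EdgeZ S x'.src x.tgt) (e34 : EdgeZ S x.tgt x'.tgt)
    (e14 : EdgeZ S x.src x'.tgt) : IsMutableZ S x ∧ flipArcZ S x = x' := by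
  have key : ∀ d : ArcZ, (∀ y ∈ S, y ≠ x → ¬ CrossZ d y) →
      (CrossZ d x → d = x') ∧ (CrossZ d x' → d = x) := by
    intro d hd
    have n12 := edge_nc e12 (y := d) fun y hy h1 h2 => hd y hy (by rintro rfl; omega)
    have n23 := edge_nc e23 (y := d) fun y hy h1 h2 => hd y hy (by rintro rfl; omega)
    have n34 := edge_nc e34 (y := d) fun y hy h1 h2 => hd y hy (by rintro rfl; omega)
    have n14 := edge_nc e14 (y := d) fun y hy h1 h2 => hd y hy (by rintro rfl; omega)
    have hd2 := d.sep
    obtain ⟨k1, k2⟩ := quad_arith h12 h23 h34 (by omega) n12 n23 n34 n14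
    exact ⟨fun h => ArcZ_ext' (k1 h).1 (k1 h).2, fun h => ArcZ_ext' (k2 h).1 (k2 h).2⟩
  exact mutable_of hS hx (by unfold CrossZ; omega) (fun d hd => (key d hd).1)
    (fun d hd => (key d fun y hy _ => hS.1 d hd y hy).2)

theorem mutable_quad24 {S : Set ArcZ} (hS : IsTriangulationZ S) {x x' : ArcZ} (hx : x ∈ S)
    (h12 : x'.src < x.src) (h23 : x.src < x'.tgt) (h34 : x'.tgt < x.tgt)
    (e12 : EdgeZ S x'.src x.src) (e23 : EdgeZ S x.src x'.tgt) (e34 : EdgeZ S x'.tgt x.tgt)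
    (e14 : EdgeZ S x'.src x.tgt) : IsMutableZ S x ∧ flipArcZ S x = x' := by
  have key : ∀ d : ArcZ, (∀ y ∈ S, y ≠ x → ¬ CrossZ d y) →
      (CrossZ d x' → d = x) ∧ (CrossZ d x → d = x') := by
    intro d hd
    have n12 := edge_nc e12 (y := d) fun y hy h1 h2 => hd y hy (by rintro rfl; omega)
    have n23 := edge_nc e23 (y := d) fun y hy h1 h2 => hd y hy (by rintro rfl; omega)
    have n34 := edge_nc e34 (y := d) fun y hy h1 h2 => hd y hy (by rintro rfl; omega)
    have n14 := edge_nc e14 (y := d) fun y hy h1 h2 => hd y hy (by rintro rfl; omega)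
    have hd2 := d.sep
    obtain ⟨k1, k2⟩ := quad_arith h12 h23 h34 (by omega) n12 n23 n34 n14
    exact ⟨fun h => ArcZ_ext' (k1 h).1 (k1 h).2, fun h => ArcZ_ext' (k2 h).1 (k2 h).2⟩
  exact mutable_of hS hx (by unfold CrossZ; omega) (fun d hd => (key d hd).2)
    (fun d hd => (key d fun y hy _ => hS.1 d hd y hy).1)

/-- A progress flip for inserting `β`. -/
theorem progress {S : Set ArcZ} (hS : IsTriangulationZ S) {β C : ArcZ} (hC : C ∈ S)
    (hu : UnderZ β C) (hβ : β ∉ S) :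
    ∃ x ∈ S, CrossZ x β ∧ IsMutableZ S x ∧ ¬ CrossZ (flipArcZ S x) β := by
  have hex : ∃ x ∈ S, CrossZ β x := by
    by_contra hcon
    push Not at hcon
    exact hβ (hS.2 β hcon)
  have hund : ∀ x ∈ S, CrossZ x β → UnderZ x C := by
    intro x hx hc
    have := hS.1 x hx C hC
    unfold UnderZ CrossZ at *
    omega
  have hfin : {x : ArcZ | x ∈ S ∧ CrossZ x β}.Finite :=
    (under_finite C).subset fun x hx => hund x hx.1 hx.2
  obtain ⟨x₀, hx₀, hc₀⟩ := hex
  obtain ⟨x, ⟨hx, hxβ⟩, hmin⟩ := Set.exists_min_image _ (fun D : ArcZ => D.tgt - D.src)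
    hfin ⟨x₀, hx₀, cross_symm hc₀⟩
  obtain ⟨s, hs1, hs2, e1, e2⟩ := triangle_below hS hx
  have key : ∀ p q, EdgeZ S p q → q - p < x.tgt - x.src →
      ¬ ((p < β.src ∧ β.src < q ∧ q < β.tgt) ∨ (β.src < p ∧ p < β.tgt ∧ β.tgt < q)) := by
    intro p q he hl hc
    rcases he with h | ⟨y, hy, h1, h2⟩
    · omega
    · have := hmin y ⟨hy, by unfold CrossZ; rw [h1, h2]; exact hc⟩
      omega
  have k1 := key _ _ e1 (by omega)
  have k2 := key _ _ e2 (by omega)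
  have hs : s = β.src ∨ s = β.tgt := by
    unfold CrossZ at hxβ; omega
  have hne : x ≠ C := by
    rintro rfl
    unfold CrossZ at hxβ; unfold UnderZ at hu; omega
  refine ⟨x, hx, hxβ, ?_⟩
  rcases triangle_above hS hx hC (hund x hx hxβ) hne with ⟨r, hr, f1, f2⟩ | ⟨r, hr, f1, f2⟩
  · obtain ⟨m1, m2⟩ := mutable_quad24 hS (x' := ⟨r, s, by omega⟩) hx hr hs1 hs2 f1 e1 e2 f2
    refine ⟨m1, ?_⟩
    rw [m2]
    unfold CrossZ; simp only; omega
  · obtain ⟨m1, m2⟩ := mutable_quad13 hS (x' := ⟨s, r, by omega⟩) hx hs1 hs2 hr e1 e2 f2 f1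
    refine ⟨m1, ?_⟩
    rw [m2]
    unfold CrossZ; simp only; omega

/-! ### Finite mutation sequences -/

noncomputable def runTZ (S : Set ArcZ) : List ArcZ → Set ArcZ
  | [] => S
  | x :: w => runTZ (mutateZ S x) w

noncomputable def runAZ (S : Set ArcZ) : List ArcZ → ArcZ → ArcZ
  | [], d => d
  | x :: w, d => runAZ (mutateZ S x) w (mutArcZ S x d)

def ValidZ (T' : Set ArcZ) (S : Set ArcZ) : List ArcZ → Prop
  | [] => True
  | x :: w => IsMutableZ S x ∧ x ∉ T' ∧ ValidZ T' (mutateZ S x) w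

theorem runTZ_append (u v : List ArcZ) : ∀ S, runTZ S (u ++ v) = runTZ (runTZ S u) v := by
  induction u with
  | nil => intro S; rfl
  | cons x u ih => intro S; exact ih _

theorem runAZ_append (u v : List ArcZ) :
    ∀ S d, runAZ S (u ++ v) d = runAZ (runTZ S u) v (runAZ S u d) := by
  induction u with
  | nil => intro S d; rfl
  | cons x u ih => intro S d; exact ih _ _

theorem ValidZ_append (T' : Set ArcZ) (u v : List ArcZ) :
    ∀ S, ValidZ T' S (u ++ v) ↔ ValidZ T' S u ∧ ValidZ T' (runTZ S u) v := by
  induction u with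
  | nil => intro S; simp [ValidZ, runTZ]
  | cons x u ih => intro S; simp [ValidZ, runTZ, ih, and_assoc]

theorem run_pred {Q : Set ArcZ → Prop} (hmut : ∀ S x, Q S → IsMutableZ S x → Q (mutateZ S x))
    (T' : Set ArcZ) (w : List ArcZ) : ∀ S, Q S → ValidZ T' S w → Q (runTZ S w) := by
  induction w with
  | nil => intro S h _; exact h
  | cons x w ih => intro S h hv; exact ih _ (hmut S x h hv.1) hv.2.2

theorem mutArc_mem {S : Set ArcZ} {x d : ArcZ} (hd : d ∈ S) : mutArcZ S x d ∈ mutateZ S x := by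
  unfold mutArcZ mutateZ
  split_ifs with h
  · exact Or.inr rfl
  · exact Or.inl ⟨hd, h⟩

theorem run_mem (w : List ArcZ) : ∀ S d, d ∈ S → runAZ S w d ∈ runTZ S w := by
  induction w with
  | nil => intro S d h; exact h
  | cons x w ih => intro S d h; exact ih _ _ (mutArc_mem h)

theorem mutArc_ne {S : Set ArcZ} {x d : ArcZ} (hd : d ≠ x) : mutArcZ S x d = d := by
  unfold mutArcZ; rw [if_neg hd]

theorem run_fix (w : List ArcZ) : ∀ S d, d ∉ w → runAZ S w d = d := by
  induction w with
  | nil => intro S d _; rfl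
  | cons x w ih =>
    intro S d h
    rw [List.mem_cons, not_or] at h
    show runAZ _ w (mutArcZ S x d) = d
    rw [mutArc_ne h.1, ih _ _ h.2]

theorem valid_notMem (T' : Set ArcZ) (w : List ArcZ) :
    ∀ S, ValidZ T' S w → ∀ d ∈ T', d ∉ w := by
  induction w with
  | nil => intro S _ d _; simp
  | cons x w ih =>
    intro S h d hd hm
    rcases List.mem_cons.1 hm with rfl | hm
    · exact h.2.1 hd
    · exact ih _ h.2.2 d hd hm

theorem run_keep {T' : Set ArcZ} {w : List ArcZ} {S : Set ArcZ} (hv : ValidZ T' S w) {d : ArcZ}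
    (hd : d ∈ T') (hdS : d ∈ S) : d ∈ runTZ S w := by
  have := run_mem w S d hdS
  rwa [run_fix w S d (valid_notMem T' w S hv d hd)] at this

theorem run_under (T' : Set ArcZ) (C : ArcZ) (hC : C ∈ T') (w : List ArcZ) :
    ∀ S d, IsTriangulationZ S → ValidZ T' S w → C ∈ S → UnderZ d C →
      UnderZ (runAZ S w d) C := by
  induction w with
  | nil => intro S d _ _ _ h; exact h
  | cons x w ih =>
    intro S d hS hv hCS hd
    have hCx : C ≠ x := by rintro rfl; exact hv.2.1 hC
    have hC' : C ∈ mutateZ S x := Or.inl ⟨hCS, hCx⟩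
    refine ih _ _ (mutable_tri hv.1) hv.2.2 hC' ?_
    unfold mutArcZ
    split_ifs with h
    · subst h
      have h1 := mutable_cross hS hv.1
      have h2 := (mutable_tri hv.1).1 _ (Or.inr rfl) C hC'
      have h3 : ¬ (d.src = C.src ∧ d.tgt = C.tgt) := fun h => hCx (ArcZ_ext' h.1.symm h.2.symm)
      unfold UnderZ CrossZ at *
      omega
    · exact hd

/-! ### Insertion -/

theorem insert_one {Q : Set ArcZ → Prop} (htri : ∀ S, Q S → IsTriangulationZ S)
    (hmut : ∀ S x, Q S → IsMutableZ S x → Q (mutateZ S x))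
    (hund : ∀ S S', Q S → Q S' → ∀ x ∈ S, ∃ C ∈ S', UnderZ x C)
    {T' : Set ArcZ} (hT' : Q T') {β : ArcZ} (hβ : β ∈ T') (n : ℕ) :
    ∀ S, Q S → {x | x ∈ S ∧ CrossZ x β}.ncard = n →
      ∃ w, ValidZ T' S w ∧ β ∈ runTZ S w ∧ ∀ x ∈ w, CrossZ x β := by
  induction n using Nat.strong_induction_on with
  | _ n ih =>
    intro S hQ hn
    by_cases hβS : β ∈ S
    · exact ⟨[], trivial, hβS, by simp⟩
    · obtain ⟨C, hC, hu⟩ := hund T' S hT' hQ β hβ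
      have hS := htri S hQ
      obtain ⟨x, hx, hxβ, hm, hf⟩ := progress hS hC hu hβS
      have hfin : {x : ArcZ | x ∈ S ∧ CrossZ x β}.Finite := by
        refine (under_finite C).subset ?_
        rintro y ⟨hy, hc⟩
        have := hS.1 y hy C hC
        unfold CrossZ at *
        simp only [UnderZ, Set.mem_ofPred_eq] at *
        omega
      have hlt : {y | y ∈ mutateZ S x ∧ CrossZ y β}.ncard < n := by
        rw [← hn]
        apply Set.ncard_lt_ncard _ hfin
        rw [Set.ssubset_iff_of_subset]
        · refine ⟨x, ⟨hx, hxβ⟩, ?_⟩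
          rintro ⟨h | h, _⟩
          · exact h.2 rfl
          · exact mutable_flip_ne hm h.symm
        · rintro y ⟨h | h, hc⟩
          · exact ⟨h.1, hc⟩
          · rw [Set.mem_singleton_iff] at h
            subst h
            exact absurd hc hf
      obtain ⟨w, h1, h2, h3⟩ := ih _ hlt (mutateZ S x) (hmut S x hQ hm) rfl
      refine ⟨x :: w, ⟨hm, ?_, h1⟩, h2, ?_⟩
      · exact fun h => (htri T' hT').1 x h β hβ hxβ
      · intro y hy
        rcases List.mem_cons.1 hy with rfl | hy
        · exact hxβ
        · exact h3 y hy

section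
variable {Q : Set ArcZ → Prop} (htri : ∀ S, Q S → IsTriangulationZ S)
    (hmut : ∀ S x, Q S → IsMutableZ S x → Q (mutateZ S x))
    (hund : ∀ S S', Q S → Q S' → ∀ x ∈ S, ∃ C ∈ S', UnderZ x C)
    {T' : Set ArcZ} (hT' : Q T')
include htri hmut hund hT'

theorem insert_many (F : List ArcZ) : (∀ β ∈ F, β ∈ T') → ∀ S, Q S →
    ∃ w, ValidZ T' S w ∧ ∀ β ∈ F, β ∈ runTZ S w := by
  induction F with
  | nil => intro _ S _; exact ⟨[], trivial, by simp⟩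
  | cons β F ih =>
    intro hF S hQ
    have hβ := hF β (by simp)
    obtain ⟨u, hu1, hu2, -⟩ := insert_one htri hmut hund hT' hβ _ S hQ rfl
    obtain ⟨v, hv1, hv2⟩ := ih (fun y hy => hF y (by simp [hy])) (runTZ S u)
      (run_pred hmut T' u S hQ hu1)
    refine ⟨u ++ v, (ValidZ_append _ _ _ _).2 ⟨hu1, hv1⟩, ?_⟩
    intro y hy
    rw [runTZ_append]
    rcases List.mem_cons.1 hy with rfl | hy
    · exact run_keep hv1 hβ hu2
    · exact hv2 y hy

theorem stabilise {S : Set ArcZ} (hQ : Q S) {g : ArcZ} (hg : g ∈ S) :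
    ∃ w, ValidZ T' S w ∧ runAZ S w g ∈ T' := by
  obtain ⟨C, hC, hgC⟩ := hund S T' hQ hT' g hg
  obtain ⟨u, hu1, hu2, hu3⟩ := insert_one htri hmut hund hT' hC _ S hQ rfl
  have hQ1 := run_pred hmut T' u S hQ hu1
  have hgu : runAZ S u g = g := by
    apply run_fix
    intro h
    have := hu3 g h
    unfold CrossZ at this
    unfold UnderZ at hgC
    omega
  have hfin : {x : ArcZ | x ∈ T' ∧ UnderZ x C}.Finite :=
    (under_finite C).subset fun x hx => hx.2
  obtain ⟨v, hv1, hv2⟩ := insert_many htri hmut hund hT' hfin.toFinset.toList (by simp; tauto)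
    (runTZ S u) hQ1
  have hv2' : ∀ x ∈ T', UnderZ x C → x ∈ runTZ (runTZ S u) v := by
    intro x h1 h2
    exact hv2 x (by simp [h1, h2])
  refine ⟨u ++ v, (ValidZ_append _ _ _ _).2 ⟨hu1, hv1⟩, ?_⟩
  rw [runAZ_append, hgu]
  have hgS1 : g ∈ runTZ S u := by
    have := run_mem u S g hg
    rwa [hgu] at this
  have h1 := run_under T' C hC v _ g (htri _ hQ1) hv1 hu2 hgC
  have h2 := run_mem v _ g hgS1
  have htr := htri _ (run_pred hmut T' v _ hQ1 hv1)
  apply (htri T' hT').2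
  intro x hx hc
  by_cases hxC : UnderZ x C
  · exact htr.1 _ h2 x (hv2' x hx hxC) hc
  · have := (htri T' hT').1 x hx C hC
    unfold CrossZ UnderZ at *
    omega

/-- One task of the construction. -/
theorem task {T : Set ArcZ} (hT : Q T) (g : ArcZ) (w : List ArcZ) (hw : ValidZ T' T w) :
    ∃ v, w <+: v ∧ ValidZ T' T v ∧ (g ∈ T → runAZ T v g ∈ T') ∧ (g ∈ T' → g ∈ runTZ T v) := by
  have hQ := run_pred hmut T' w T hT hw
  have h1 : ∃ u, ValidZ T' (runTZ T w) u ∧ (g ∈ T → runAZ T (w ++ u) g ∈ T') := by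
    by_cases hg : g ∈ T
    · obtain ⟨u, h1, h2⟩ := stabilise htri hmut hund hT' hQ (run_mem w T g hg)
      exact ⟨u, h1, fun _ => by rw [runAZ_append]; exact h2⟩
    · exact ⟨[], trivial, fun h => absurd h hg⟩
  obtain ⟨u, hu1, hu2⟩ := h1
  have hwu : ValidZ T' T (w ++ u) := (ValidZ_append _ _ _ _).2 ⟨hw, hu1⟩
  have hQ2 := run_pred hmut T' _ T hT hwu
  have h2 : ∃ v, ValidZ T' (runTZ T (w ++ u)) v ∧ (g ∈ T' → g ∈ runTZ (runTZ T (w ++ u)) v) := by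
    by_cases hg : g ∈ T'
    · obtain ⟨v, h1, h2, -⟩ := insert_one htri hmut hund hT' hg _ _ hQ2 rfl
      exact ⟨v, h1, fun _ => h2⟩
    · exact ⟨[], trivial, fun h => absurd h hg⟩
  obtain ⟨v, hv1, hv2⟩ := h2
  refine ⟨(w ++ u) ++ v, ?_, (ValidZ_append _ _ _ _).2 ⟨hwu, hv1⟩, ?_, ?_⟩
  · rw [List.append_assoc]; exact List.prefix_append _ _
  · intro hg
    rw [runAZ_append, run_fix _ _ _ (valid_notMem T' v _ hv1 _ (hu2 hg))]
    exact hu2 hg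
  · intro hg
    rw [runTZ_append]
    exact hv2 hg

end

/-! ### From lists to sequences -/

theorem iter_agree (T : Set ArcZ) (θ : ℕ → Option ArcZ) (w : List ArcZ) :
    (∀ i, i < w.length → θ i = w[i]?) →
      iterTZ T θ w.length = runTZ T w ∧ ∀ d, iterAZ T θ d w.length = runAZ T w d := by
  induction w using List.reverseRecOn with
  | nil => intro _; exact ⟨rfl, fun _ => rfl⟩
  | append_singleton w x ih =>
    intro h
    obtain ⟨h1, h2⟩ := ih (by
      intro i hi
      rw [h i (by simp; omega), List.getElem?_append_left hi])
    have h3 : θ w.length = some x := by rw [h _ (by simp)]; simp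
    rw [List.length_append, List.length_singleton]
    constructor
    · show stepTZ _ _ = _
      rw [h1, h3, runTZ_append]; rfl
    · intro d
      show stepAZ _ _ _ = _
      rw [h1, h2, h3, runAZ_append]; rfl

theorem iter_surj {T : Set ArcZ} {θ : ℕ → Option ArcZ}
    (hθ : ∀ i x, θ i = some x → IsMutableZ (iterTZ T θ i) x) (k : ℕ) :
    ∀ d ∈ iterTZ T θ k, ∃ g ∈ T, iterAZ T θ g k = d := by
  induction k with
  | zero => intro d hd; exact ⟨d, hd, rfl⟩
  | succ k ih =>
    intro d hd
    change d ∈ stepTZ (iterTZ T θ k) (θ k) at hd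
    change ∃ g ∈ T, stepAZ (iterTZ T θ k) (θ k) (iterAZ T θ g k) = d
    cases hx : θ k with
    | none =>
      rw [hx] at hd
      exact ih d hd
    | some x =>
      rw [hx] at hd
      rcases hd with hd | hd
      · obtain ⟨g, hg, h⟩ := ih d hd.1
        refine ⟨g, hg, ?_⟩
        rw [h]
        exact mutArc_ne hd.2
      · obtain ⟨g, hg, h⟩ := ih x (hθ k x hx).1
        refine ⟨g, hg, ?_⟩
        rw [h]
        rw [Set.mem_singleton_iff] at hd
        rw [hd]
        show mutArcZ _ _ _ = _
        unfold mutArcZ; rw [if_pos rfl]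

theorem iter_mem {T : Set ArcZ} {θ : ℕ → Option ArcZ} (k : ℕ) :
    ∀ g ∈ T, iterAZ T θ g k ∈ iterTZ T θ k := by
  induction k with
  | zero => intro d hd; exact hd
  | succ k ih =>
    intro g hg
    change stepAZ (iterTZ T θ k) (θ k) (iterAZ T θ g k) ∈ stepTZ (iterTZ T θ k) (θ k)
    cases hx : θ k with
    | none => exact ih g hg
    | some x => exact mutArc_mem (ih g hg)

theorem iter_stable {T T' : Set ArcZ} {θ : ℕ → Option ArcZ}
    (hθ : ∀ i x, θ i = some x → x ∉ T') {g : ArcZ} {l : ℕ} (h : iterAZ T θ g l ∈ T') (k : ℕ)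
    (hk : l ≤ k) : iterAZ T θ g k = iterAZ T θ g l := by
  induction k, hk using Nat.le_induction with
  | base => rfl
  | succ k hk ih =>
    show stepAZ (iterTZ T θ k) (θ k) (iterAZ T θ g k) = _
    rw [ih]
    cases hx : θ k with
    | none => rfl
    | some x =>
      apply mutArc_ne
      rintro h2
      exact hθ k x hx (h2 ▸ h)

theorem seqLimit_eq {T : Set ArcZ} {θ : ℕ → Option ArcZ} {g : ArcZ} {l : ℕ}
    (h : ∀ k, l ≤ k → iterAZ T θ g k = iterAZ T θ g l) : seqLimitZ T θ g = iterAZ T θ g l := by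
  have hex : ∃ l, ∀ k, l ≤ k → iterAZ T θ g k = iterAZ T θ g l := ⟨l, h⟩
  unfold seqLimitZ
  rw [dif_pos hex, ← hex.choose_spec (max l hex.choose) (le_max_right _ _),
    h _ (le_max_left _ _)]

theorem leS_of {Q : Set ArcZ → Prop} (htri : ∀ S, Q S → IsTriangulationZ S)
    (hmut : ∀ S x, Q S → IsMutableZ S x → Q (mutateZ S x))
    (hund : ∀ S S', Q S → Q S' → ∀ x ∈ S, ∃ C ∈ S', UnderZ x C)
    {T T' : Set ArcZ} (hT : Q T) (hT' : Q T') : leS T T' := by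
  have : Nonempty ArcZ := ⟨⟨0, 2, by norm_num⟩⟩
  obtain ⟨e, he⟩ := exists_surjective_nat ArcZ
  choose nxt hn1 hn2 hn3 hn4 using task htri hmut hund hT' hT
  let ws : ℕ → {w : List ArcZ // ValidZ T' T w} := fun n =>
    Nat.rec ⟨[], trivial⟩ (fun n w => ⟨nxt (e n) w.1 w.2, hn2 _ _ _⟩) n
  have hsucc : ∀ n, ws (n + 1) = ⟨nxt (e n) (ws n).1 (ws n).2, hn2 _ _ _⟩ := fun n => rfl
  have hpre1 : ∀ n, (ws n).1 <+: (ws (n + 1)).1 := fun n => by rw [hsucc]; exact hn1 _ _ _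
  have hpre : ∀ m n, m ≤ n → (ws m).1 <+: (ws n).1 := by
    intro m n hmn
    induction n, hmn using Nat.le_induction with
    | base => exact List.prefix_rfl
    | succ n _ ih => exact ih.trans (hpre1 n)
  let θ : ℕ → Option ArcZ := fun i =>
    if h : ∃ n, i < (ws n).1.length then (ws h.choose).1[i]? else none
  have hθ : ∀ n i, i < (ws n).1.length → θ i = (ws n).1[i]? := by
    intro n i hi
    have hex : ∃ n, i < (ws n).1.length := ⟨n, hi⟩
    have h1 : θ i = (ws hex.choose).1[i]? := dif_pos hex
    rw [h1]
    have hc := hex.choose_spec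
    rcases le_total n hex.choose with h | h
    · obtain ⟨t, ht⟩ := hpre _ _ h
      rw [← ht, List.getElem?_append_left hi]
    · obtain ⟨t, ht⟩ := hpre _ _ h
      rw [← ht, List.getElem?_append_left hc]
  have hsome : ∀ i x, θ i = some x → ∃ n, i < (ws n).1.length := by
    intro i x hx
    by_contra hcon
    have : θ i = none := dif_neg hcon
    rw [this] at hx
    cases hx
  have hval : ∀ i x, θ i = some x → IsMutableZ (iterTZ T θ i) x ∧ x ∉ T' := by
    intro i x hx
    obtain ⟨n, hn⟩ := hsome i x hx
    have h1 := hθ n i hn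
    rw [hx] at h1
    obtain ⟨_, h2⟩ := List.getElem?_eq_some_iff.1 h1.symm
    have hlen : ((ws n).1.take i).length = i := by simp; omega
    have h3 := (iter_agree T θ ((ws n).1.take i) (by
      intro j hj
      rw [hlen] at hj
      rw [hθ n j (by omega), List.getElem?_take_of_lt hj])).1
    rw [hlen] at h3
    have h4 : (ws n).1 = (ws n).1.take i ++ (x :: (ws n).1.drop (i + 1)) := by
      rw [← h2, List.getElem_cons_drop, List.take_append_drop]
    have h5 := (ws n).2
    rw [h4, ValidZ_append] at h5
    rw [h3]
    exact ⟨h5.2.1, h5.2.2.1⟩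
  have hA : ∀ g ∈ T, ∃ l, iterAZ T θ g l ∈ T' := by
    intro g hg
    obtain ⟨n, rfl⟩ := he g
    refine ⟨(ws (n + 1)).1.length, ?_⟩
    rw [(iter_agree T θ _ (hθ (n + 1))).2, hsucc]
    exact hn3 _ _ _ hg
  have hB : ∀ g ∈ T', ∃ l, g ∈ iterTZ T θ l := by
    intro g hg
    obtain ⟨n, rfl⟩ := he g
    refine ⟨(ws (n + 1)).1.length, ?_⟩
    rw [(iter_agree T θ _ (hθ (n + 1))).1, hsucc]
    exact hn4 _ _ _ hg
  have hst := fun g l h => iter_stable (T := T) (fun i x hx => (hval i x hx).2) (g := g) (l := l) h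
  refine ⟨θ, ⟨?_, fun i x hx => (hval i x hx).1, ?_⟩, ?_⟩
  · intro i hi
    by_contra hcon
    obtain ⟨x, hx⟩ := Option.ne_none_iff_exists'.1 hcon
    obtain ⟨n, hn⟩ := hsome _ x hx
    have := hθ n i (by omega)
    rw [hi, List.getElem?_eq_getElem (by omega)] at this
    cases this
  · intro g hg
    obtain ⟨l, hl⟩ := hA g hg
    exact ⟨l, hst g l hl⟩
  · apply Set.Subset.antisymm
    · rintro _ ⟨g, hg, rfl⟩
      obtain ⟨l, hl⟩ := hA g hg
      rw [seqLimit_eq (hst g l hl)]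
      exact hl
    · intro d hd
      obtain ⟨l, hl⟩ := hB d hd
      obtain ⟨g, hg, h⟩ := iter_surj (fun i x hx => (hval i x hx).1) l d hl
      refine ⟨g, hg, ?_⟩
      rw [seqLimit_eq (hst g l (by rw [h]; exact hd)), h]

/-! ### Locally finite triangulations -/

theorem lf_mutate {S : Set ArcZ} (h : LocallyFinZ S) (x : ArcZ) : LocallyFinZ (mutateZ S x) := by
  intro v
  refine ((h v).union (Set.finite_singleton (flipArcZ S x))).subset ?_
  rintro y ⟨hy | hy, hv⟩
  · exact Or.inl ⟨hy.1, hv⟩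
  · exact Or.inr hy

theorem lf_right_bdd {S : Set ArcZ} (h : LocallyFinZ S) (v : ℤ) :
    ∃ B, ∀ z, EdgeZ S v z → z ≤ B := by
  have hf := (h v).image ArcZ.tgt
  obtain ⟨B, hB⟩ := hf.bddAbove
  refine ⟨max B (v + 1), ?_⟩
  rintro z (hz | ⟨x, hx, h1, h2⟩)
  · rw [hz]; exact le_max_right _ _
  · refine le_trans ?_ (le_max_left _ _)
    exact hB ⟨x, ⟨hx, Or.inl h1⟩, h2⟩

theorem lf_strict {S : Set ArcZ} (hS : IsTriangulationZ S) (h : LocallyFinZ S) {p q : ℤ}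
    (he : EdgeZ S p q) : ∃ i j, EdgeZ S i j ∧ i ≤ p ∧ q ≤ j ∧ q - p < j - i := by
  by_contra hcon
  push Not at hcon
  have hmax : ∀ z, EdgeZ S p z → z ≤ q := by
    intro z hz
    by_contra hlt
    have := hcon p z hz le_rfl (by omega)
    omega
  have hmin : ∀ z, EdgeZ S z q → p ≤ z := by
    intro z hz
    by_contra hlt
    have := hcon z q hz (by omega) le_rfl
    omega
  have hpq := edge_lt he
  have h1 : ∃ j, EdgeZ S q j ∧ q + 1 < j := by
    by_contra hno
    push Not at hno
    have := hmax (q + 1) (edge_of_nc hS (by omega) ?_)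
    · omega
    · intro y hy hc
      have n1 := edge_nc' hS he hy
      by_cases hyq : y.tgt = q
      · have := hmin y.src (Or.inr ⟨y, hy, rfl, hyq⟩)
        omega
      · by_cases hyq' : y.src = q
        · have := hno y.tgt (Or.inr ⟨y, hy, hyq', rfl⟩)
          omega
        · omega
  obtain ⟨j₀, hj₀, hj₀'⟩ := h1
  obtain ⟨B, hB⟩ := lf_right_bdd h q
  obtain ⟨j, hj, hjmax⟩ := exists_max_int (P := fun z => EdgeZ S q z) B hB j₀ hj₀
  have hqj := edge_lt hj
  have := hmax j (edge_of_nc hS (by omega) ?_)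
  · omega
  · intro y hy hc
    have n1 := edge_nc' hS he hy
    have n2 := edge_nc' hS hj hy
    by_cases hyq : y.tgt = q
    · have := hmin y.src (Or.inr ⟨y, hy, rfl, hyq⟩)
      omega
    · by_cases hyq' : y.src = q
      · have := hjmax y.tgt (Or.inr ⟨y, hy, hyq', rfl⟩)
        omega
      · omega

theorem lf_cover {S : Set ArcZ} (hS : IsTriangulationZ S) (h : LocallyFinZ S) (p q : ℤ) :
    ∃ C ∈ S, C.src ≤ p ∧ q ≤ C.tgt := by
  by_contra hcon
  push Not at hcon
  have hfin : {C : ArcZ | C ∈ S ∧ C.src ≤ p ∧ p + 1 ≤ C.tgt}.Finite := by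
    refine ((Set.finite_Ico (p + 1) q).biUnion fun v _ => h v).subset ?_
    rintro C ⟨hC, h1, h2⟩
    have := hcon C hC h1
    exact Set.mem_biUnion (x := C.tgt) ⟨h2, this⟩ ⟨hC, Or.inr rfl⟩
  have hstep : ∀ i j, EdgeZ S i j → i ≤ p → p + 1 ≤ j →
      ∃ C ∈ S, C.src ≤ p ∧ p + 1 ≤ C.tgt ∧ j - i < C.tgt - C.src := by
    intro i j he h1 h2
    obtain ⟨i', j', he', h3, h4, h5⟩ := lf_strict hS h he
    have := edge_lt he
    exact ⟨⟨i', j', by omega⟩, edge_mem he' (by omega), by simp only; omega, by simp only; omega, h5⟩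
  obtain ⟨C₀, hC₀, h1, h2, -⟩ := hstep p (p + 1) (Or.inl rfl) le_rfl le_rfl
  obtain ⟨C, ⟨hC, h3, h4⟩, hmax⟩ := Set.exists_max_image _ (fun D : ArcZ => D.tgt - D.src)
    hfin ⟨C₀, hC₀, h1, h2⟩
  obtain ⟨D, hD, h5, h6, h7⟩ := hstep C.src C.tgt (Or.inr ⟨C, hC, rfl, rfl⟩) h3 h4
  have := hmax D ⟨hD, h5, h6⟩
  omega

theorem leS_lf {T T' : Set ArcZ} (hT : IsTriangulationZ T) (hT' : IsTriangulationZ T')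
    (h : LocallyFinZ T) (h' : LocallyFinZ T') : leS T T' := by
  refine leS_of (Q := fun S => IsTriangulationZ S ∧ LocallyFinZ S) (fun S h => h.1)
    (fun S x h hm => ⟨mutable_tri hm, lf_mutate h.2 x⟩) ?_ ⟨hT, h⟩ ⟨hT', h'⟩
  intro S S' _ h2 x _
  obtain ⟨C, hC, h3⟩ := lf_cover h2.1 h2.2 x.src x.tgt
  exact ⟨C, hC, h3⟩

/-! ### Fountains -/

theorem rf_far {S : Set ArcZ} {b : ℤ} (h : RightFountainZ S b) (N : ℤ) :
    ∃ x ∈ S, x.src = b ∧ N < x.tgt := by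
  by_contra hcon
  push Not at hcon
  apply h
  refine (Set.finite_Icc b N).subset ?_
  rintro p ⟨x, hx, h1, rfl⟩
  have := hcon x hx h1
  have := x.sep
  exact ⟨by omega, by omega⟩

theorem lfo_far {S : Set ArcZ} {a : ℤ} (h : LeftFountainZ S a) (N : ℤ) :
    ∃ x ∈ S, x.tgt = a ∧ x.src < N := by
  by_contra hcon
  push Not at hcon
  apply h
  refine (Set.finite_Icc N a).subset ?_
  rintro p ⟨x, hx, rfl, h1⟩
  have := hcon x hx h1
  have := x.sep
  exact ⟨by omega, by omega⟩

theorem rf_of_far {S : Set ArcZ} {b : ℤ} (h : ∀ N, ∃ x ∈ S, x.src = b ∧ N < x.tgt) :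
    RightFountainZ S b := by
  intro hfin
  obtain ⟨B, hB⟩ := hfin.bddAbove
  obtain ⟨x, hx, h1, h2⟩ := h B
  have : x.tgt ≤ B := hB ⟨x, hx, h1, rfl⟩
  omega

theorem lfo_of_far {S : Set ArcZ} {a : ℤ} (h : ∀ N, ∃ x ∈ S, x.tgt = a ∧ x.src < N) :
    LeftFountainZ S a := by
  intro hfin
  obtain ⟨B, hB⟩ := hfin.bddBelow
  obtain ⟨x, hx, h1, h2⟩ := h B
  have : B ≤ x.src := hB ⟨x, hx, rfl, h1⟩
  omega

theorem rf_mutate {S : Set ArcZ} {b : ℤ} (h : RightFountainZ S b) (x : ArcZ) :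
    RightFountainZ (mutateZ S x) b := by
  apply rf_of_far
  intro N
  obtain ⟨y, hy, h1, h2⟩ := rf_far h (max N x.tgt)
  rw [max_lt_iff] at h2
  exact ⟨y, Or.inl ⟨hy, by rintro rfl; omega⟩, h1, h2.1⟩

theorem lfo_mutate {S : Set ArcZ} {a : ℤ} (h : LeftFountainZ S a) (x : ArcZ) :
    LeftFountainZ (mutateZ S x) a := by
  apply lfo_of_far
  intro N
  obtain ⟨y, hy, h1, h2⟩ := lfo_far h (min N x.src)
  rw [lt_min_iff] at h2
  exact ⟨y, Or.inl ⟨hy, by rintro rfl; omega⟩, h1, h2.1⟩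

theorem rf_not_over {S : Set ArcZ} (hS : IsTriangulationZ S) {b : ℤ} (h : RightFountainZ S b) :
    ∀ x ∈ S, ¬ (x.src < b ∧ b < x.tgt) := by
  intro x hx hc
  obtain ⟨y, hy, h1, h2⟩ := rf_far h x.tgt
  have := hS.1 x hx y hy
  unfold CrossZ at this
  omega

theorem lfo_not_over {S : Set ArcZ} (hS : IsTriangulationZ S) {a : ℤ} (h : LeftFountainZ S a) :
    ∀ x ∈ S, ¬ (x.src < a ∧ a < x.tgt) := by
  intro x hx hc
  obtain ⟨y, hy, h1, h2⟩ := lfo_far h x.src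
  have := hS.1 x hx y hy
  unfold CrossZ at this
  omega

theorem leS_fountain {T T' : Set ArcZ} (hT : IsTriangulationZ T) (hT' : IsTriangulationZ T')
    {a b : ℤ} (h1 : LeftFountainZ T a) (h2 : RightFountainZ T b)
    (h1' : LeftFountainZ T' a) (h2' : RightFountainZ T' b) : leS T T' := by
  refine leS_of (Q := fun S => IsTriangulationZ S ∧ LeftFountainZ S a ∧ RightFountainZ S b)
    (fun S h => h.1)
    (fun S x h hm => ⟨mutable_tri hm, lfo_mutate h.2.1 x, rf_mutate h.2.2 x⟩) ?_ ⟨hT, h1, h2⟩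
    ⟨hT', h1', h2'⟩
  rintro S S' ⟨hS, hl, hr⟩ ⟨hS', hl', hr'⟩ x hx
  have n1 := rf_not_over hS hr x hx
  have n2 := lfo_not_over hS hl x hx
  have hsep := x.sep
  by_cases c1 : x.tgt ≤ a
  · obtain ⟨C, hC, h3, h4⟩ := lfo_far hl' x.src
    exact ⟨C, hC, h4.le, by omega⟩
  by_cases c2 : b ≤ x.src
  · obtain ⟨C, hC, h3, h4⟩ := rf_far hr' x.tgt
    exact ⟨C, hC, by omega, h4.le⟩
  · refine ⟨⟨a, b, by omega⟩, ?_, by unfold UnderZ; simp only; omega⟩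
    apply hS'.2
    intro y hy hc
    have m1 := rf_not_over hS' hr' y hy
    have m2 := lfo_not_over hS' hl' y hy
    unfold CrossZ at hc
    simp only at hc
    omega

/-- A right fountain forces a left fountain. -/
theorem exists_left {S : Set ArcZ} (hS : IsTriangulationZ S) {b : ℤ} (h : RightFountainZ S b) :
    ∃ a ≤ b, LeftFountainZ S a := by
  by_contra hcon
  push Not at hcon
  have hbd : ∀ v ≤ b, ∃ m, EdgeZ S m v ∧ ∀ z, EdgeZ S z v → m ≤ z := by
    intro v hv
    have h1 : ∃ N, ∀ x ∈ S, x.tgt = v → N ≤ x.src := by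
      by_contra h2
      push Not at h2
      exact hcon v hv (lfo_of_far h2)
    obtain ⟨N, hN⟩ := h1
    refine exists_min_int (P := fun z => EdgeZ S z v) (min N (v - 1)) ?_ (v - 1) (Or.inl (by omega))
    rintro z (hz | ⟨x, hx, h1, h2⟩)
    · have := min_le_right N (v - 1); omega
    · have := min_le_left N (v - 1); have := hN x hx h2; omega
  obtain ⟨c, hc, hcmin⟩ := hbd b le_rfl
  have hcb := edge_lt hc
  obtain ⟨d, hd, hdmin⟩ := hbd c hcb.le
  have hdc := edge_lt hd
  have := hcmin d (edge_of_nc hS (by omega) ?_)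
  · omega
  · intro y hy hcr
    have n1 := edge_nc' hS hc hy
    have n2 := edge_nc' hS hd hy
    have n3 := rf_not_over hS h y hy
    by_cases hyc : y.tgt = c
    · have := hdmin y.src (Or.inr ⟨y, hy, rfl, hyc⟩)
      omega
    · omega

/-- A left fountain forces a right fountain. -/
theorem exists_right {S : Set ArcZ} (hS : IsTriangulationZ S) {a : ℤ} (h : LeftFountainZ S a) :
    ∃ b, a ≤ b ∧ RightFountainZ S b := by
  by_contra hcon
  push Not at hcon
  have hbd : ∀ v, a ≤ v → ∃ m, EdgeZ S v m ∧ ∀ z, EdgeZ S v z → z ≤ m := by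
    intro v hv
    have h1 : ∃ N, ∀ x ∈ S, x.src = v → x.tgt ≤ N := by
      by_contra h2
      push Not at h2
      exact hcon v hv (rf_of_far h2)
    obtain ⟨N, hN⟩ := h1
    refine exists_max_int (P := fun z => EdgeZ S v z) (max N (v + 1)) ?_ (v + 1) (Or.inl rfl)
    rintro z (hz | ⟨x, hx, h1, h2⟩)
    · have := le_max_right N (v + 1); omega
    · have := le_max_left N (v + 1); have := hN x hx h1; omega
  obtain ⟨c, hc, hcmax⟩ := hbd a le_rfl
  have hcb := edge_lt hc
  obtain ⟨d, hd, hdmax⟩ := hbd c hcb.le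
  have hdc := edge_lt hd
  have := hcmax d (edge_of_nc hS (by omega) ?_)
  · omega
  · intro y hy hcr
    have n1 := edge_nc' hS hc hy
    have n2 := edge_nc' hS hd hy
    have n3 := lfo_not_over hS h y hy
    by_cases hyc : y.src = c
    · have := hdmax y.tgt (Or.inr ⟨y, hy, hyc, rfl⟩)
      omega
    · omega

theorem exists_fountains {S : Set ArcZ} (hS : IsTriangulationZ S) (h : ¬ LocallyFinZ S) :
    ∃ a b, a ≤ b ∧ LeftFountainZ S a ∧ RightFountainZ S b := by
  unfold LocallyFinZ at h
  push Not at h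
  obtain ⟨v, hv⟩ := h
  by_cases hl : LeftFountainZ S v
  · obtain ⟨b, h1, h2⟩ := exists_right hS hl
    exact ⟨v, b, h1, hl, h2⟩
  by_cases hr : RightFountainZ S v
  · obtain ⟨a, h1, h2⟩ := exists_left hS hr
    exact ⟨a, v, h1, h2, hr⟩
  · exfalso
    apply hv
    unfold LeftFountainZ at hl
    unfold RightFountainZ at hr
    rw [Set.not_infinite] at hl hr
    have hf := (hl.prod (Set.finite_singleton v)).union ((Set.finite_singleton v).prod hr)
    refine (hf.preimage ArcZ_inj.injOn).subset ?_
    rintro x ⟨hx, h1 | h1⟩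
    · exact Or.inr ⟨h1, x, hx, h1, rfl⟩
    · exact Or.inl ⟨⟨x, hx, rfl, h1⟩, h1⟩

/-! ### Limits of mutation sequences -/

theorem iter_pred {Q : Set ArcZ → Prop} (hmut : ∀ S x, Q S → IsMutableZ S x → Q (mutateZ S x))
    {T : Set ArcZ} {θ : ℕ → Option ArcZ} (hT : Q T)
    (hθ : ∀ i x, θ i = some x → IsMutableZ (iterTZ T θ i) x) (k : ℕ) : Q (iterTZ T θ k) := by
  induction k with
  | zero => exact hT
  | succ k ih =>
    change Q (stepTZ (iterTZ T θ k) (θ k))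
    cases hx : θ k with
    | none => exact ih
    | some x => exact hmut _ _ ih (hθ k x hx)

theorem leS_arc {Q : Set ArcZ → Prop} (hmut : ∀ S x, Q S → IsMutableZ S x → Q (mutateZ S x))
    {T T' : Set ArcZ} (hT : Q T) (h : leS T T') : ∀ x ∈ T', ∃ S, Q S ∧ x ∈ S := by
  obtain ⟨θ, ⟨-, h2, h3⟩, rfl⟩ := h
  rintro _ ⟨g, hg, rfl⟩
  obtain ⟨l, hl⟩ := h3 g hg
  rw [seqLimit_eq hl]
  exact ⟨_, iter_pred hmut hT h2 l, iter_mem l g hg⟩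

theorem leS_fountain_le {T T' : Set ArcZ} (hT : IsTriangulationZ T) (hT' : IsTriangulationZ T')
    {a b : ℤ} (ha : LeftFountainZ T a) (hb : RightFountainZ T b) (h : leS T T') :
    ¬ LocallyFinZ T' ∧ (∀ a', LeftFountainZ T' a' → a' ≤ a) ∧
      (∀ b', RightFountainZ T' b' → b ≤ b') := by
  have hno : ∀ x ∈ T', ¬ (x.src < a ∧ a < x.tgt) ∧ ¬ (x.src < b ∧ b < x.tgt) := by
    intro x hx
    obtain ⟨S, ⟨hS, h1, h2⟩, hxS⟩ := leS_arc
      (Q := fun S => IsTriangulationZ S ∧ LeftFountainZ S a ∧ RightFountainZ S b)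
      (fun S x h hm => ⟨mutable_tri hm, lfo_mutate h.2.1 x, rf_mutate h.2.2 x⟩)
      ⟨hT, ha, hb⟩ h x hx
    exact ⟨lfo_not_over hS h1 x hxS, rf_not_over hS h2 x hxS⟩
  refine ⟨?_, ?_, ?_⟩
  · intro hlf
    obtain ⟨C, hC, h1, h2⟩ := lf_cover hT' hlf (a - 1) (a + 1)
    have := hno C hC
    omega
  · intro a' ha'
    obtain ⟨x, hx, h1, h2⟩ := lfo_far ha' a
    have := hno x hx
    omega
  · intro b' hb'
    obtain ⟨x, hx, h1, h2⟩ := rf_far hb' b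
    have := hno x hx
    omega

/-- Two triangulations of the ∞-gon are strongly mutation equivalent if and only if they are
both locally finite, or they both have a left fountain at `a` and a right fountain at `b`
for some `a ≤ b` in `ℤ`. -/
theorem statement14 (T T' : Set ArcZ) (hT : IsTriangulationZ T) (hT' : IsTriangulationZ T') :
    (leS T T' ∧ leS T' T) ↔
      ((LocallyFinZ T ∧ LocallyFinZ T') ∨
        ∃ a b : ℤ, a ≤ b ∧ LeftFountainZ T a ∧ RightFountainZ T b ∧
          LeftFountainZ T' a ∧ RightFountainZ T' b) := by
  constructor
  · rintro ⟨h1, h2⟩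
    by_cases hl : LocallyFinZ T
    · left
      refine ⟨hl, ?_⟩
      by_contra hl'
      obtain ⟨a, b, _, ha, hb⟩ := exists_fountains hT' hl'
      exact (leS_fountain_le hT' hT ha hb h2).1 hl
    · right
      obtain ⟨a, b, hab, ha, hb⟩ := exists_fountains hT hl
      obtain ⟨k1, k2, k3⟩ := leS_fountain_le hT hT' ha hb h1
      obtain ⟨a', b', _, ha', hb'⟩ := exists_fountains hT' k1
      obtain ⟨-, m2, m3⟩ := leS_fountain_le hT' hT ha' hb' h2
      have e1 : a' = a := le_antisymm (k2 a' ha') (m2 a ha)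
      have e2 : b' = b := le_antisymm (m3 b hb) (k3 b' hb')
      subst e1; subst e2
      exact ⟨a', b', hab, ha, hb, ha', hb'⟩
  · rintro (⟨h, h'⟩ | ⟨a, b, _, h1, h2, h3, h4⟩)
    · exact ⟨leS_lf hT hT' h h', leS_lf hT' hT h' h⟩
    · exact ⟨leS_fountain hT hT' h1 h2 h3 h4, leS_fountain hT' hT h3 h4 h1 h2⟩
end
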